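/- arXiv:1409.5661 — 3 statements merged into one kernel-verified Lean document; each statement's English description precedes it below -/
import Mathlib

section
/- For every ε > 0 there exists N such that for all n ≥ N, the number f_max(n) of maximal sum-free subsets of [n] satisfies 2^{(1/4 − ε)n} ≤ f_max(n) ≤ 2^{(1/4 + ε)n}. -/
/-- A set of naturals is sum-free: no `x, y ∈ S` (not necessarily distinct) with `x + y ∈ S`. -/
def SumFree (S : Finset ℕ) : Prop := ∀ x ∈ S, ∀ y ∈ S, x + y ∉ S

/-- `S` is a maximal sum-free subset of `[n] = {1, …, n}`. -/
def IsMaxSumFree (n : ℕ) (S : Finset ℕ) : Prop :=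
  S ⊆ Finset.Icc 1 n ∧ SumFree S ∧
    ∀ T : Finset ℕ, T ⊆ Finset.Icc 1 n → SumFree T → S ⊆ T → S = T

/-- The number of maximal sum-free subsets of `[n]`. -/
noncomputable def fmax (n : ℕ) : ℕ := {S : Finset ℕ | IsMaxSumFree n S}.ncard

open Finset

/-- `J` is a maximal independent subset of the vertex set `V` in the graph `G`. -/
def IsMaxIndepIn {α : Type*} (G : SimpleGraph α) (V J : Finset α) : Prop :=
  J ⊆ V ∧ (∀ u ∈ J, ∀ v ∈ J, ¬ G.Adj u v) ∧ ∀ v ∈ V, v ∉ J → ∃ u ∈ J, G.Adj v u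

open Classical in
/-- The maximal independent subsets of the vertex set `V` in the graph `G`. -/
noncomputable def maxIndepFinset {α : Type*} (G : SimpleGraph α) (V : Finset α) :
    Finset (Finset α) :=
  V.powerset.filter (IsMaxIndepIn G V)

section MaxIndep

variable {α : Type*} {G : SimpleGraph α}

lemma mem_maxIndepFinset {V J : Finset α} : J ∈ maxIndepFinset G V ↔ IsMaxIndepIn G V J := by
  classical
  simp only [maxIndepFinset, mem_filter, mem_powerset, and_iff_right_iff_imp]
  exact fun h => h.1

open Classical in
lemma IsMaxIndepIn.restrict [DecidableEq α] {V V' X J : Finset α}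
    (h : IsMaxIndepIn G V J) (hV : V' ⊆ V)
    (hJ : J ⊆ X ∪ V') (hX : ∀ x ∈ X, ∀ v ∈ V', ¬ G.Adj x v) :
    IsMaxIndepIn G V' (J ∩ V') := by
  refine ⟨inter_subset_right, fun u hu v hv => h.2.1 u (mem_inter.1 hu).1 v (mem_inter.1 hv).1, ?_⟩
  intro v hv hvJ
  obtain ⟨u, hu, huv⟩ := h.2.2 v (hV hv) fun hh => hvJ (mem_inter.2 ⟨hh, hv⟩)
  refine ⟨u, mem_inter.2 ⟨hu, ?_⟩, huv⟩
  rcases mem_union.1 (hJ hu) with hx | hx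
  · exact absurd huv.symm (hX u hx v hv)
  · exact hx

open Classical in
lemma card_maxIndep_superset_le {V X W : Finset α} {c : ℝ} (hc : 0 ≤ c)
    (ih : ∀ V' ⊂ V, (#(maxIndepFinset G V') : ℝ) ≤ 2 ^ (c * #V'))
    (hWV : W ⊆ V) (hWne : W.Nonempty) (hW : ∀ w ∈ W, w ∈ X ∨ ∃ x ∈ X, G.Adj x w) :
    (#{J ∈ maxIndepFinset G V | X ⊆ J} : ℝ) ≤ 2 ^ (c * #V) * 2 ^ (-(c * #W)) := by
  set V' := V.filter (fun v => v ∉ X ∧ ∀ x ∈ X, ¬ G.Adj x v) with hV'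
  have hsub : V' ⊆ V \ W := by
    intro v hv
    rw [hV', mem_filter] at hv
    refine mem_sdiff.2 ⟨hv.1, fun hvW => ?_⟩
    rcases hW v hvW with h | ⟨x, hx, h⟩
    · exact hv.2.1 h
    · exact hv.2.2 x hx h
  have hcard : #V' + #W ≤ #V := by
    have := card_le_card hsub
    have := card_sdiff_add_card_eq_card hWV
    omega
  have hss : V' ⊂ V := by
    refine (filter_subset _ _).ssubset_of_ne fun h => ?_
    have := hWne.card_pos
    have h' : V' = V := h
    rw [h'] at hcard
    omega
  have hJ : ∀ J ∈ maxIndepFinset G V, X ⊆ J → J ⊆ X ∪ V' := by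
    intro J hJ hX u hu
    rw [mem_maxIndepFinset] at hJ
    by_cases hux : u ∈ X
    · exact mem_union_left _ hux
    · refine mem_union_right _ (mem_filter.2 ⟨hJ.1 hu, hux, fun x hx => hJ.2.1 x (hX hx) u hu⟩)
  have h1 : #{J ∈ maxIndepFinset G V | X ⊆ J} ≤ #(maxIndepFinset G V') := by
    refine card_le_card_of_injOn (fun J => J ∩ V') ?_ ?_
    · intro J hJ'
      rw [mem_coe, mem_filter] at hJ'
      rw [mem_coe, mem_maxIndepFinset]
      refine (mem_maxIndepFinset.1 hJ'.1).restrict (filter_subset _ _) (hJ J hJ'.1 hJ'.2) ?_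
      intro x hx v hv
      exact (mem_filter.1 hv).2.2 x hx
    · intro J hJ1 K hK1 hJK
      rw [mem_coe, mem_filter] at hJ1 hK1
      have key : ∀ A, A ∈ maxIndepFinset G V → X ⊆ A → A = X ∪ A ∩ V' := by
        intro A hA hXA
        refine Subset.antisymm (fun a ha => ?_) (union_subset hXA inter_subset_left)
        rcases mem_union.1 (hJ A hA hXA ha) with h | h
        · exact mem_union_left _ h
        · exact mem_union_right _ (mem_inter.2 ⟨ha, h⟩)
      rw [key J hJ1.1 hJ1.2, key K hK1.1 hK1.2]
      exact congrArg _ hJK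
  calc (#{J ∈ maxIndepFinset G V | X ⊆ J} : ℝ) ≤ #(maxIndepFinset G V') := by exact_mod_cast h1
    _ ≤ 2 ^ (c * #V') := ih V' hss
    _ ≤ 2 ^ (c * #V - c * #W) := by
        refine Real.rpow_le_rpow_of_exponent_le (by norm_num) ?_
        have : (#V' : ℝ) + #W ≤ #V := by exact_mod_cast hcard
        nlinarith
    _ = _ := by rw [sub_eq_add_neg, Real.rpow_add (by norm_num)]

open Classical in
/-- Branching on the closed neighbourhood of a vertex `v` of minimum degree. -/
lemma card_maxIndep_le_of_min_degree {V : Finset α} {c : ℝ} (hc : 0 ≤ c)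
    (ih : ∀ V' ⊂ V, (#(maxIndepFinset G V') : ℝ) ≤ 2 ^ (c * #V')) {v : α} (hv : v ∈ V)
    (hmin : ∀ u ∈ V, #(V.filter (G.Adj v)) ≤ #(V.filter (G.Adj u)))
    (hk : ((#(V.filter (G.Adj v)) + 1 : ℕ) : ℝ) ≤ 2 ^ (c * (#(V.filter (G.Adj v)) + 1 : ℕ))) :
    (#(maxIndepFinset G V) : ℝ) ≤ 2 ^ (c * #V) := by
  set k := #(V.filter (G.Adj v)) + 1 with hkdef
  have hcl : ∀ u, #(insert u (V.filter (G.Adj u))) = #(V.filter (G.Adj u)) + 1 := fun u =>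
    card_insert_of_notMem (by simp)
  have hcover : maxIndepFinset G V ⊆ (insert v (V.filter (G.Adj v))).biUnion
      fun u => {J ∈ maxIndepFinset G V | {u} ⊆ J} := by
    intro J hJ
    have hJ' := mem_maxIndepFinset.1 hJ
    rw [mem_biUnion]
    by_cases hvJ : v ∈ J
    · exact ⟨v, mem_insert_self _ _, mem_filter.2 ⟨hJ, by simpa using hvJ⟩⟩
    · obtain ⟨u, hu, huv⟩ := hJ'.2.2 v hv hvJ
      exact ⟨u, mem_insert_of_mem (mem_filter.2 ⟨hJ'.1 hu, huv⟩),
        mem_filter.2 ⟨hJ, by simpa using hu⟩⟩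
  have hb : ∀ u ∈ insert v (V.filter (G.Adj v)),
      (#{J ∈ maxIndepFinset G V | {u} ⊆ J} : ℝ) ≤ 2 ^ (c * #V) * 2 ^ (-(c * k)) := by
    intro u hu
    have huV : u ∈ V := by
      rcases mem_insert.1 hu with rfl | h
      · exact hv
      · exact (mem_filter.1 h).1
    refine (card_maxIndep_superset_le hc ih (X := {u}) (W := insert u (V.filter (G.Adj u)))
      (insert_subset huV (filter_subset _ _)) (insert_nonempty _ _) ?_).trans ?_
    · intro w hw
      rcases mem_insert.1 hw with rfl | h
      · exact Or.inl (mem_singleton_self _)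
      · exact Or.inr ⟨u, mem_singleton_self _, (mem_filter.1 h).2⟩
    · refine mul_le_mul_of_nonneg_left ?_ (by positivity)
      refine Real.rpow_le_rpow_of_exponent_le (by norm_num) ?_
      have : (k : ℝ) ≤ #(insert u (V.filter (G.Adj u))) := by
        rw [hcl]; exact_mod_cast Nat.succ_le_succ (hmin u huV)
      nlinarith
  have h1 : (#(maxIndepFinset G V) : ℝ) ≤
      ∑ u ∈ insert v (V.filter (G.Adj v)), (#{J ∈ maxIndepFinset G V | {u} ⊆ J} : ℝ) := by
    exact_mod_cast (card_le_card hcover).trans card_biUnion_le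
  refine h1.trans ((sum_le_sum hb).trans ?_)
  rw [sum_const, hcl, nsmul_eq_mul, ← hkdef]
  calc (k : ℝ) * (2 ^ (c * #V) * 2 ^ (-(c * k)))
      ≤ 2 ^ (c * k) * (2 ^ (c * #V) * 2 ^ (-(c * k))) := by
        refine mul_le_mul_of_nonneg_right hk (by positivity)
    _ = 2 ^ (c * #V) * (2 ^ (c * k) * 2 ^ (-(c * k))) := by ring
    _ = 2 ^ (c * #V) := by rw [← Real.rpow_add (by norm_num)]; simp

lemma card_maxIndep_empty : #(maxIndepFinset G ∅) ≤ 1 := by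
  classical
  refine (card_filter_le _ _).trans ?_
  simp

lemma cast_le_two_rpow (k : ℕ) : (k : ℝ) ≤ 2 ^ ((8 / 15 : ℝ) * k) := by
  have h3 : ∀ m : ℕ, m ^ 3 ≤ 3 ^ m := by
    intro m
    rcases Nat.lt_or_ge m 3 with h | h
    · interval_cases m <;> norm_num
    · induction m, h using Nat.le_induction with
      | base => norm_num
      | succ m hm ih =>
        rw [pow_succ 3 m]
        nlinarith [mul_le_mul hm hm (by positivity) (by positivity)]
  have h15 : (k : ℝ) ^ 15 ≤ (2 ^ ((8 / 15 : ℝ) * k)) ^ 15 := by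
    rw [← Real.rpow_natCast (2 ^ _) 15, ← Real.rpow_mul (by norm_num)]
    have e : (8 / 15 : ℝ) * k * (15 : ℕ) = (8 * k : ℕ) := by push_cast; ring
    rw [e, Real.rpow_natCast]
    have : k ^ 15 ≤ 2 ^ (8 * k) := by
      calc k ^ 15 = (k ^ 3) ^ 5 := by ring
        _ ≤ (3 ^ k) ^ 5 := Nat.pow_le_pow_left (h3 k) 5
        _ = 243 ^ k := by rw [← pow_mul, mul_comm, pow_mul]; norm_num
        _ ≤ 256 ^ k := Nat.pow_le_pow_left (by norm_num) k
        _ = 2 ^ (8 * k) := by rw [pow_mul]; norm_num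
    exact_mod_cast this
  exact le_of_pow_le_pow_left₀ (by norm_num) (by positivity) h15

/-- A weak form of the Moon–Moser theorem. -/
theorem card_maxIndep_le (V : Finset α) :
    (#(maxIndepFinset G V) : ℝ) ≤ 2 ^ ((8 / 15 : ℝ) * #V) := by
  classical
  induction V using Finset.strongInduction with
  | H V ih =>
    rcases V.eq_empty_or_nonempty with rfl | hne
    · simpa using card_maxIndep_empty (G := G)
    · obtain ⟨v, hv, hmin⟩ := exists_min_image V (fun u => #(V.filter (G.Adj u))) hne
      exact card_maxIndep_le_of_min_degree (by norm_num) ih hv hmin (cast_le_two_rpow _)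

lemma cast_le_two_rpow_half {k : ℕ} (hk : 1 ≤ k) (hk3 : k ≠ 3) :
    (k : ℝ) ≤ 2 ^ ((1 / 2 : ℝ) * k) := by
  have h2 : (k : ℝ) ^ 2 ≤ (2 ^ ((1 / 2 : ℝ) * k)) ^ 2 := by
    rw [← Real.rpow_natCast (2 ^ _) 2, ← Real.rpow_mul (by norm_num)]
    have e : (1 / 2 : ℝ) * k * (2 : ℕ) = (k : ℕ) := by push_cast; ring
    rw [e, Real.rpow_natCast]
    have : k ^ 2 ≤ 2 ^ k := by
      rcases Nat.lt_or_ge k 4 with h | h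
      · interval_cases k <;> simp_all
      · clear hk hk3 e
        induction k, h using Nat.le_induction with
        | base => norm_num
        | succ m hm ih => rw [pow_succ 2 m]; nlinarith
    exact_mod_cast this
  exact le_of_pow_le_pow_left₀ (by norm_num) (by positivity) h2

set_option maxHeartbeats 1000000 in
open Classical in
/-- The Hujter–Tuza theorem: a triangle-free graph on `m` vertices has at most `2 ^ (m / 2)`
maximal independent sets. -/
theorem card_maxIndep_le_of_triangleFree (V : Finset α)
    (hV : ∀ a ∈ V, ∀ b ∈ V, ∀ c ∈ V, G.Adj a b → G.Adj b c → ¬ G.Adj a c) :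
    (#(maxIndepFinset G V) : ℝ) ≤ 2 ^ ((1 / 2 : ℝ) * #V) := by
  induction V using Finset.strongInduction with
  | H V ih' =>
    have ih : ∀ V' ⊂ V, (#(maxIndepFinset G V') : ℝ) ≤ 2 ^ ((1 / 2 : ℝ) * #V') := fun V' h =>
      ih' V' h fun a ha b hb c hc => hV a (h.1 ha) b (h.1 hb) c (h.1 hc)
    rcases V.eq_empty_or_nonempty with rfl | hne
    · simpa using card_maxIndep_empty (G := G)
    obtain ⟨v, hv, hmin⟩ := exists_min_image V (fun u => #(V.filter (G.Adj u))) hne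
    by_cases hk3 : #(V.filter (G.Adj v)) + 1 = 3
    swap
    · exact card_maxIndep_le_of_min_degree (by norm_num) ih hv hmin
        (cast_le_two_rpow_half (by omega) hk3)
    have hbr : ∀ (X W : Finset α), W ⊆ V → W.Nonempty →
        (∀ w ∈ W, w ∈ X ∨ ∃ x ∈ X, G.Adj x w) → ∀ j : ℕ, j ≤ #W →
        (#{J ∈ maxIndepFinset G V | X ⊆ J} : ℝ) ≤
          2 ^ ((1 / 2 : ℝ) * #V) * 2 ^ (-((1 / 2 : ℝ) * j)) := by
      intro X W h1 h2 h3 j hj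
      refine (card_maxIndep_superset_le (by norm_num) ih h1 h2 h3).trans ?_
      refine mul_le_mul_of_nonneg_left ?_ (by positivity)
      refine Real.rpow_le_rpow_of_exponent_le (by norm_num) ?_
      have : (j : ℝ) ≤ #W := by exact_mod_cast hj
      linarith
    have p3 : (2 : ℝ) ^ (-((1 / 2 : ℝ) * (3 : ℕ))) ≤ 0.354 := by
      refine le_of_pow_le_pow_left₀ (n := 2) (by norm_num) (by norm_num) ?_
      rw [← Real.rpow_natCast (2 ^ _) 2, ← Real.rpow_mul (by norm_num)]
      norm_num
    have p4 : (2 : ℝ) ^ (-((1 / 2 : ℝ) * (4 : ℕ))) ≤ 0.25 := by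
      norm_num
    have p5 : (2 : ℝ) ^ (-((1 / 2 : ℝ) * (5 : ℕ))) ≤ 0.177 := by
      refine le_of_pow_le_pow_left₀ (n := 2) (by norm_num) (by norm_num) ?_
      rw [← Real.rpow_natCast (2 ^ _) 2, ← Real.rpow_mul (by norm_num)]
      norm_num
    set q : ℝ := 2 ^ ((1 / 2 : ℝ) * #V) with hq
    have hq0 : 0 < q := by positivity
    obtain ⟨u₁, u₂, hu12, hN⟩ := card_eq_two.1 (show #(V.filter (G.Adj v)) = 2 by omega)
    have hm : ∀ u, u ∈ V ∧ G.Adj v u ↔ u = u₁ ∨ u = u₂ := fun u => by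
      rw [← mem_filter, hN]; simp
    obtain ⟨h1V, h1v⟩ := (hm u₁).2 (Or.inl rfl)
    obtain ⟨h2V, h2v⟩ := (hm u₂).2 (Or.inr rfl)
    have h12 : ¬ G.Adj u₁ u₂ := fun h => hV v hv u₁ h1V u₂ h2V h1v h h2v
    have hcl : ∀ u, #(insert u (V.filter (G.Adj u))) = #(V.filter (G.Adj u)) + 1 := fun u =>
      card_insert_of_notMem (by simp)
    have hsingle : ∀ u ∈ V, ∀ j : ℕ, j ≤ #(V.filter (G.Adj u)) + 1 →
        (#{J ∈ maxIndepFinset G V | {u} ⊆ J} : ℝ) ≤ q * 2 ^ (-((1 / 2 : ℝ) * j)) := by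
      intro u hu j hj
      refine hbr {u} (insert u (V.filter (G.Adj u))) (insert_subset hu (filter_subset _ _))
        (insert_nonempty _ _) ?_ j (by rw [hcl]; exact hj)
      intro w hw
      rcases mem_insert.1 hw with rfl | h
      · exact Or.inl (mem_singleton_self _)
      · exact Or.inr ⟨u, mem_singleton_self _, (mem_filter.1 h).2⟩
    have hbv := hsingle v hv 3 (by omega)
    have hd1 := hmin u₁ h1V
    have hd2 := hmin u₂ h2V
    have hcover : ∀ J ∈ maxIndepFinset G V, v ∈ J ∨ u₁ ∈ J ∨ u₂ ∈ J := by
      intro J hJ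
      by_cases hvJ : v ∈ J
      · exact Or.inl hvJ
      · obtain ⟨u, hu, huv⟩ := (mem_maxIndepFinset.1 hJ).2.2 v hv hvJ
        rcases (hm u).1 ⟨(mem_maxIndepFinset.1 hJ).1 hu, huv⟩ with rfl | rfl
        · exact Or.inr (Or.inl hu)
        · exact Or.inr (Or.inr hu)
    have hdeg : ∀ u, #(V.filter (G.Adj u)) = 2 → u ∈ V → G.Adj v u →
        ∃ w, w ∈ V ∧ w ≠ v ∧ G.Adj u w ∧ ∀ x ∈ V, G.Adj u x → x = v ∨ x = w := by
      intro u hu2 huV huv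
      obtain ⟨a, b, hab, hh⟩ := card_eq_two.1 hu2
      have hm' : ∀ x, x ∈ V ∧ G.Adj u x ↔ x = a ∨ x = b := fun x => by
        rw [← mem_filter, hh]; simp
      rcases (hm' v).1 ⟨hv, huv.symm⟩ with rfl | rfl
      · obtain ⟨hb1, hb2⟩ := (hm' b).2 (Or.inr rfl)
        exact ⟨b, hb1, hab.symm, hb2, fun x hx hux => (hm' x).1 ⟨hx, hux⟩⟩
      · obtain ⟨hb1, hb2⟩ := (hm' a).2 (Or.inl rfl)
        exact ⟨a, hb1, hab, hb2, fun x hx hux => ((hm' x).1 ⟨hx, hux⟩).symm⟩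
    by_cases hA : 3 ≤ #(V.filter (G.Adj u₁)) ∨ 3 ≤ #(V.filter (G.Adj u₂))
    · have hsum : (#{J ∈ maxIndepFinset G V | {u₁} ⊆ J} : ℝ) +
          #{J ∈ maxIndepFinset G V | {u₂} ⊆ J} ≤ q * 0.354 + q * 0.25 := by
        rcases hA with h | h
        · have a1 := hsingle u₁ h1V 4 (by omega)
          have a2 := hsingle u₂ h2V 3 (by omega)
          nlinarith
        · have a1 := hsingle u₁ h1V 3 (by omega)
          have a2 := hsingle u₂ h2V 4 (by omega)
          nlinarith
      have hc : maxIndepFinset G V ⊆ {J ∈ maxIndepFinset G V | {v} ⊆ J} ∪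
          ({J ∈ maxIndepFinset G V | {u₁} ⊆ J} ∪ {J ∈ maxIndepFinset G V | {u₂} ⊆ J}) := by
        intro J hJ
        have := hcover J hJ
        simp only [mem_union, mem_filter, singleton_subset_iff, hJ, true_and]
        exact this
      have hc' := (card_le_card hc).trans ((card_union_le _ _).trans
        (Nat.add_le_add_left (card_union_le _ _) _))
      have hc'' : (#(maxIndepFinset G V) : ℝ) ≤ #{J ∈ maxIndepFinset G V | {v} ⊆ J} +
          (#{J ∈ maxIndepFinset G V | {u₁} ⊆ J} + #{J ∈ maxIndepFinset G V | {u₂} ⊆ J}) := by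
        exact_mod_cast hc'
      nlinarith
    · push Not at hA
      obtain ⟨w₁, hw1V, hw1v, hw1a, hw1⟩ := hdeg u₁ (by omega) h1V h1v
      obtain ⟨w₂, hw2V, hw2v, hw2a, hw2⟩ := hdeg u₂ (by omega) h2V h2v
      have n1 : w₁ ≠ u₁ := fun h => by subst h; exact G.loopless.irrefl _ hw1a
      have n2 : w₂ ≠ u₂ := fun h => by subst h; exact G.loopless.irrefl _ hw2a
      have n3 : w₁ ≠ u₂ := fun h => by subst h; exact h12 hw1a
      have n4 : w₂ ≠ u₁ := fun h => by subst h; exact h12 hw2a.symm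
      have n5 : u₁ ≠ v := h1v.ne'
      have n6 : u₂ ≠ v := h2v.ne'
      have hother : ∀ J ∈ maxIndepFinset G V, v ∉ J →
          (u₁ ∉ J → w₁ ∈ J) ∧ (u₂ ∉ J → w₂ ∈ J) := by
        intro J hJ hvJ
        have hJ' := mem_maxIndepFinset.1 hJ
        constructor
        · intro h
          obtain ⟨u, hu, huv⟩ := hJ'.2.2 _ h1V h
          rcases hw1 u (hJ'.1 hu) huv with rfl | rfl
          · exact absurd hu hvJ
          · exact hu
        · intro h
          obtain ⟨u, hu, huv⟩ := hJ'.2.2 _ h2V h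
          rcases hw2 u (hJ'.1 hu) huv with rfl | rfl
          · exact absurd hu hvJ
          · exact hu
      by_cases hw : w₁ = w₂
      · subst hw
        have b := hbr {u₁, u₂} {v, u₁, u₂, w₁}
          (by simp [insert_subset_iff, hv, h1V, h2V, hw1V]) (insert_nonempty _ _)
          (by
            intro w hw
            simp only [mem_insert, mem_singleton] at hw ⊢
            rcases hw with rfl | rfl | rfl | rfl
            · exact Or.inr ⟨u₁, Or.inl rfl, h1v.symm⟩
            · simp
            · simp
            · exact Or.inr ⟨u₁, Or.inl rfl, hw1a⟩) 4
          (by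
            rw [card_insert_of_notMem, card_insert_of_notMem, card_insert_of_notMem,
              card_singleton] <;> simp [*, Ne.symm, hw1v.symm, n5.symm, n6.symm, n1.symm, n3.symm])
        have hc : maxIndepFinset G V ⊆ {J ∈ maxIndepFinset G V | {v} ⊆ J} ∪
            {J ∈ maxIndepFinset G V | {u₁, u₂} ⊆ J} := by
          intro J hJ
          have := hcover J hJ
          have h2 := hother J hJ
          have h3 := (mem_maxIndepFinset.1 hJ).2.1
          have h4 : u₁ ∈ J → w₁ ∉ J := fun a b => h3 _ a _ b hw1a
          have h5 : u₂ ∈ J → w₁ ∉ J := fun a b => h3 _ a _ b hw2a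
          simp only [mem_union, mem_filter, singleton_subset_iff, insert_subset_iff, hJ, true_and]
          clear * - this h2 h4 h5
          by_cases v ∈ J <;> by_cases u₁ ∈ J <;> by_cases u₂ ∈ J <;> simp_all
        have hc' : (#(maxIndepFinset G V) : ℝ) ≤ #{J ∈ maxIndepFinset G V | {v} ⊆ J} +
            #{J ∈ maxIndepFinset G V | {u₁, u₂} ⊆ J} := by
          exact_mod_cast (card_le_card hc).trans (card_union_le _ _)
        nlinarith
      · have hcard5 : 5 ≤ #({v, u₁, u₂, w₁, w₂} : Finset α) := by
          rw [card_insert_of_notMem, card_insert_of_notMem, card_insert_of_notMem,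
            card_insert_of_notMem, card_singleton] <;>
            simp [*, hw1v.symm, hw2v.symm, n5.symm, n6.symm, n1.symm, n2.symm, n3.symm, n4.symm]
        have hsub5 : ({v, u₁, u₂, w₁, w₂} : Finset α) ⊆ V := by
          simp [insert_subset_iff, hv, h1V, h2V, hw1V, hw2V]
        have b1 := hbr {u₁, u₂} _ hsub5 (insert_nonempty _ _) (by
            intro w hw
            simp only [mem_insert, mem_singleton] at hw ⊢
            rcases hw with rfl | rfl | rfl | rfl | rfl
            · exact Or.inr ⟨u₁, Or.inl rfl, h1v.symm⟩
            · simp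
            · simp
            · exact Or.inr ⟨u₁, Or.inl rfl, hw1a⟩
            · exact Or.inr ⟨u₂, Or.inr rfl, hw2a⟩) 5 hcard5
        have b2 := hbr {u₁, w₂} _ hsub5 (insert_nonempty _ _) (by
            intro w hw
            simp only [mem_insert, mem_singleton] at hw ⊢
            rcases hw with rfl | rfl | rfl | rfl | rfl
            · exact Or.inr ⟨u₁, Or.inl rfl, h1v.symm⟩
            · simp
            · exact Or.inr ⟨w₂, Or.inr rfl, hw2a.symm⟩
            · exact Or.inr ⟨u₁, Or.inl rfl, hw1a⟩
            · simp) 5 hcard5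
        have b3 := hbr {u₂, w₁} _ hsub5 (insert_nonempty _ _) (by
            intro w hw
            simp only [mem_insert, mem_singleton] at hw ⊢
            rcases hw with rfl | rfl | rfl | rfl | rfl
            · exact Or.inr ⟨u₂, Or.inl rfl, h2v.symm⟩
            · exact Or.inr ⟨w₁, Or.inr rfl, hw1a.symm⟩
            · simp
            · simp
            · exact Or.inr ⟨u₂, Or.inl rfl, hw2a⟩) 5 hcard5
        have hc : maxIndepFinset G V ⊆ {J ∈ maxIndepFinset G V | {v} ⊆ J} ∪
            ({J ∈ maxIndepFinset G V | {u₁, u₂} ⊆ J} ∪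
            ({J ∈ maxIndepFinset G V | {u₁, w₂} ⊆ J} ∪
              {J ∈ maxIndepFinset G V | {u₂, w₁} ⊆ J})) := by
          intro J hJ
          have := hcover J hJ
          have h2 := hother J hJ
          simp only [mem_union, mem_filter, singleton_subset_iff, insert_subset_iff, hJ, true_and]
          clear * - this h2
          by_cases v ∈ J <;> by_cases u₁ ∈ J <;> by_cases u₂ ∈ J <;> simp_all
        have hc' : (#(maxIndepFinset G V) : ℝ) ≤ #{J ∈ maxIndepFinset G V | {v} ⊆ J} +
            (#{J ∈ maxIndepFinset G V | {u₁, u₂} ⊆ J} +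
            (#{J ∈ maxIndepFinset G V | {u₁, w₂} ⊆ J} +
              #{J ∈ maxIndepFinset G V | {u₂, w₁} ⊆ J})) := by
          exact_mod_cast (card_le_card hc).trans ((card_union_le _ _).trans
            (Nat.add_le_add_left ((card_union_le _ _).trans
              (Nat.add_le_add_left (card_union_le _ _) _)) _))
        nlinarith

open Classical in
/-- If every triangle in `V` meets `W`, then guessing the part of the independent set inside `W`
reduces to the triangle-free case. -/
theorem card_maxIndep_le_of_triangles_meet [DecidableEq α] (V W : Finset α) (hW : W ⊆ V)
    (hV : ∀ a ∈ V \ W, ∀ b ∈ V \ W, ∀ c ∈ V \ W, G.Adj a b → G.Adj b c → ¬ G.Adj a c) :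
    (#(maxIndepFinset G V) : ℝ) ≤ 2 ^ ((1 / 2 : ℝ) * (#V + #W)) := by
  have hcover : maxIndepFinset G V ⊆ W.powerset.biUnion
      fun X => {J ∈ maxIndepFinset G V | J ∩ W = X} := by
    intro J hJ
    rw [mem_biUnion]
    exact ⟨J ∩ W, mem_powerset.2 inter_subset_right, mem_filter.2 ⟨hJ, rfl⟩⟩
  have hb : ∀ X ∈ W.powerset, (#{J ∈ maxIndepFinset G V | J ∩ W = X} : ℝ) ≤
      2 ^ ((1 / 2 : ℝ) * (#V - #W)) := by
    intro X _
    set V' := (V \ W).filter (fun v => ∀ x ∈ X, ¬ G.Adj x v) with hV'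
    have hV'sub : V' ⊆ V \ W := filter_subset _ _
    have h1 : #{J ∈ maxIndepFinset G V | J ∩ W = X} ≤ #(maxIndepFinset G V') := by
      have hJ : ∀ J ∈ maxIndepFinset G V, J ∩ W = X → J ⊆ X ∪ V' := by
        intro J hJ hX u hu
        have hJ' := mem_maxIndepFinset.1 hJ
        by_cases huW : u ∈ W
        · exact mem_union_left _ (hX ▸ mem_inter.2 ⟨hu, huW⟩)
        · refine mem_union_right _ (mem_filter.2 ⟨mem_sdiff.2 ⟨hJ'.1 hu, huW⟩, fun x hx => ?_⟩)
          exact hJ'.2.1 x (mem_inter.1 (hX.symm ▸ hx)).1 u hu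
      refine card_le_card_of_injOn (fun J => J ∩ V') ?_ ?_
      · intro J hJ'
        rw [mem_coe, mem_filter] at hJ'
        rw [mem_coe, mem_maxIndepFinset]
        refine (mem_maxIndepFinset.1 hJ'.1).restrict (hV'sub.trans sdiff_subset)
          (hJ J hJ'.1 hJ'.2) ?_
        intro x hx v hv
        exact (mem_filter.1 hv).2 x hx
      · intro J hJ1 K hK1 hJK
        rw [mem_coe, mem_filter] at hJ1 hK1
        have key : ∀ A, A ∈ maxIndepFinset G V → A ∩ W = X → A = X ∪ A ∩ V' := by
          intro A hA hXA
          refine Subset.antisymm (fun a ha => ?_) (union_subset (hXA ▸ inter_subset_left)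
            inter_subset_left)
          rcases mem_union.1 (hJ A hA hXA ha) with h | h
          · exact mem_union_left _ h
          · exact mem_union_right _ (mem_inter.2 ⟨ha, h⟩)
        rw [key J hJ1.1 hJ1.2, key K hK1.1 hK1.2]
        exact congrArg _ hJK
    calc (#{J ∈ maxIndepFinset G V | J ∩ W = X} : ℝ) ≤ #(maxIndepFinset G V') := by
          exact_mod_cast h1
      _ ≤ 2 ^ ((1 / 2 : ℝ) * #V') := card_maxIndep_le_of_triangleFree V' fun a ha b hb c hc =>
          hV a (hV'sub ha) b (hV'sub hb) c (hV'sub hc)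
      _ ≤ _ := by
          refine Real.rpow_le_rpow_of_exponent_le (by norm_num) ?_
          have e : (#(V \ W) : ℝ) + #W = #V := by exact_mod_cast card_sdiff_add_card_eq_card hW
          have : (#V' : ℝ) ≤ #(V \ W) := by exact_mod_cast card_le_card hV'sub
          linarith
  have h1 : (#(maxIndepFinset G V) : ℝ) ≤
      ∑ X ∈ W.powerset, (#{J ∈ maxIndepFinset G V | J ∩ W = X} : ℝ) := by
    exact_mod_cast (card_le_card hcover).trans card_biUnion_le
  refine h1.trans ((sum_le_sum hb).trans ?_)
  rw [sum_const, card_powerset, nsmul_eq_mul, Nat.cast_pow, Nat.cast_ofNat, ← Real.rpow_natCast,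
    ← Real.rpow_add (by norm_num)]
  refine Real.rpow_le_rpow_of_exponent_le (by norm_num) ?_
  linarith

end MaxIndep

open Classical in
/-- The Kleitman–Winston algorithm: each independent set `I` of a graph has a small subset `T`
which determines a subset `C T` of the vertices, inducing a graph of maximum degree less than `d`,
such that `I ⊆ T ∪ C T`. -/
theorem exists_fingerprint {α : Type*} [DecidableEq α] (G : SimpleGraph α) (d : ℕ) (V : Finset α) :
    ∃ C : Finset α → Finset α,
      (∀ T, C T ⊆ V ∧ ∀ v ∈ C T, #((C T).filter (G.Adj v)) < d + 1) ∧
      ∀ I ⊆ V, (∀ u ∈ I, ∀ v ∈ I, ¬ G.Adj u v) →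
        ∃ T ⊆ I, (d + 1) * #T ≤ #V ∧ I ⊆ T ∪ C T ∧ ∀ t ∈ T, ∀ v ∈ C T, ¬ G.Adj t v := by
  induction V using Finset.strongInduction with
  | H V ih =>
    by_cases hdeg : ∀ v ∈ V, #(V.filter (G.Adj v)) < d + 1
    · refine ⟨fun _ => V, fun _ => ⟨Subset.rfl, hdeg⟩, fun I hI _ => ?_⟩
      exact ⟨∅, empty_subset _, by simp, by simpa using hI, by simp⟩
    push Not at hdeg
    obtain ⟨v, hv, hd⟩ := hdeg
    set N := V.filter (G.Adj v) with hN
    have hvN : v ∉ N := by simp [hN]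
    have hsub : (V \ insert v N) ⊆ V.erase v := by
      intro x hx
      simp only [mem_sdiff, mem_insert, not_or] at hx
      exact mem_erase.2 ⟨hx.2.1, hx.1⟩
    have hss : V.erase v ⊂ V := erase_ssubset hv
    obtain ⟨C₁, h1, h1'⟩ := ih _ hss
    obtain ⟨C₂, h2, h2'⟩ := ih (V \ insert v N) (hsub.trans_ssubset hss)
    refine ⟨fun T => if v ∈ T then C₂ (T.erase v) else C₁ T, fun T => ?_, fun I hI hind => ?_⟩
    · by_cases hT : v ∈ T
      · simp only [hT, if_true]
        exact ⟨(h2 _).1.trans sdiff_subset, (h2 _).2⟩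
      · simp only [hT, if_false]
        exact ⟨(h1 _).1.trans (erase_subset _ _), (h1 _).2⟩
    · by_cases hvI : v ∈ I
      · have hI2 : I.erase v ⊆ V \ insert v N := by
          intro x hx
          obtain ⟨hxv, hxI⟩ := mem_erase.1 hx
          simp only [mem_sdiff, mem_insert, not_or]
          exact ⟨hI hxI, hxv, fun h => hind v hvI x hxI (mem_filter.1 h).2⟩
        obtain ⟨T, hTI, hT, hIT, hTC⟩ := h2' (I.erase v) hI2 fun u hu w hw =>
          hind u (mem_erase.1 hu).2 w (mem_erase.1 hw).2
        have hvT : v ∉ T := fun h => (mem_erase.1 (hTI h)).1 rfl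
        refine ⟨insert v T, insert_subset hvI (hTI.trans (erase_subset _ _)), ?_, ?_, ?_⟩
        · rw [card_insert_of_notMem hvT]
          have e1 := card_sdiff_add_card_eq_card (s := insert v N) (t := V)
            (insert_subset hv (filter_subset _ _))
          rw [card_insert_of_notMem hvN] at e1
          have : (d + 1) * (#T + 1) = (d + 1) * #T + (d + 1) := by ring
          omega
        · simp only [mem_insert_self, if_true, erase_insert hvT]
          intro x hx
          by_cases hxv : x = v
          · simp [hxv]
          · have := hIT (mem_erase.2 ⟨hxv, hx⟩)
            simp only [mem_union, mem_insert] at this ⊢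
            tauto
        · simp only [mem_insert_self, if_true, erase_insert hvT]
          intro t ht w hw
          rcases mem_insert.1 ht with rfl | ht
          · have := (h2 T).1 hw
            simp only [mem_sdiff, mem_insert, not_or, hN, mem_filter, not_and] at this
            exact this.2.2 this.1
          · exact hTC t ht w hw
      · obtain ⟨T, hTI, hT, hIT, hTC⟩ := h1' I (fun x hx =>
          mem_erase.2 ⟨fun h => hvI (h ▸ hx), hI hx⟩) hind
        have hvT : v ∉ T := fun h => hvI (hTI h)
        refine ⟨T, hTI, hT.trans (card_le_card (erase_subset _ _)), ?_, ?_⟩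
        · simpa only [hvT, if_false] using hIT
        · simpa only [hvT, if_false] using hTC

/-- The subsets of `V` with at most `r` elements. -/
noncomputable def smallSubsets {α : Type*} (V : Finset α) (r : ℝ) : Finset (Finset α) :=
  V.powerset.filter fun T => (#T : ℝ) ≤ r

lemma mem_smallSubsets {α : Type*} {V T : Finset α} {r : ℝ} :
    T ∈ smallSubsets V r ↔ T ⊆ V ∧ (#T : ℝ) ≤ r := by
  simp [smallSubsets]

theorem exists_card_smallSubsets_le {η : ℝ} (hη : 0 < η) :
    ∃ γ : ℝ, 0 < γ ∧ ∀ {α : Type} (n : ℕ) (V : Finset α), #V ≤ n →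
      (#(smallSubsets V (γ * n)) : ℝ) ≤ 2 ^ (η * n) := by
  have h1 : (1 : ℝ) < 2 ^ (η / 2) := Real.one_lt_rpow (by norm_num) (by positivity)
  set x : ℝ := min (2 ^ (η / 2) - 1) (1 / 2) with hx
  have hx0 : 0 < x := lt_min (by linarith) (by norm_num)
  have hx1 : x < 1 := (min_le_right _ _).trans_lt (by norm_num)
  have hx2 : x + 1 ≤ 2 ^ (η / 2) := by
    have := min_le_left ((2 : ℝ) ^ (η / 2) - 1) (1 / 2)
    linarith
  set a : ℝ := -Real.logb 2 x with ha
  have ha0 : 0 < a := by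
    have := Real.logb_neg (b := 2) (by norm_num) hx0 hx1
    linarith
  have hxa : x = 2 ^ (-a) := by
    rw [ha, neg_neg, Real.rpow_logb (by norm_num) (by norm_num) hx0]
  refine ⟨η / (2 * a), by positivity, fun n V hV => ?_⟩
  have hterm : ∀ T ∈ smallSubsets V (η / (2 * a) * n),
      (1 : ℝ) ≤ 2 ^ (η / 2 * n) * (x ^ #T * 1 ^ (#V - #T)) := by
    intro T hT
    have hT' := (mem_smallSubsets.1 hT).2
    rw [one_pow, mul_one, hxa, ← Real.rpow_natCast, ← Real.rpow_mul (by norm_num),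
      ← Real.rpow_add (by norm_num)]
    refine Real.one_le_rpow (by norm_num) ?_
    have : a * #T ≤ a * (η / (2 * a) * n) := mul_le_mul_of_nonneg_left hT' ha0.le
    have e : a * (η / (2 * a) * n) = η / 2 * n := by field_simp
    linarith
  calc (#(smallSubsets V (η / (2 * a) * n)) : ℝ)
      = ∑ T ∈ smallSubsets V (η / (2 * a) * n), (1 : ℝ) := by simp
    _ ≤ ∑ T ∈ smallSubsets V (η / (2 * a) * n),
          2 ^ (η / 2 * n) * (x ^ #T * 1 ^ (#V - #T)) := sum_le_sum hterm
    _ ≤ ∑ T ∈ V.powerset, 2 ^ (η / 2 * n) * (x ^ #T * 1 ^ (#V - #T)) := by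
        refine sum_le_sum_of_subset_of_nonneg (filter_subset _ _) fun _ _ _ => by positivity
    _ = 2 ^ (η / 2 * n) * (x + 1) ^ #V := by
        rw [← mul_sum, sum_pow_mul_eq_add_pow]
    _ ≤ 2 ^ (η / 2 * n) * (2 ^ (η / 2)) ^ n := by
        refine mul_le_mul_of_nonneg_left ?_ (by positivity)
        exact (pow_le_pow_left₀ (by linarith) hx2 _).trans (pow_le_pow_right₀ h1.le hV)
    _ = 2 ^ (η * n) := by
        rw [← Real.rpow_natCast, ← Real.rpow_mul (by norm_num), ← Real.rpow_add (by norm_num)]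
        congr 1; ring

/-- The pairs of elements of `F` whose sum lies in `F`. -/
def schurPairs (F : Finset ℕ) : Finset (ℕ × ℕ) := (F ×ˢ F).filter fun p => p.1 + p.2 ∈ F

/-- Two distinct numbers are adjacent when their difference lies in `S`. -/
def diffGraph (S : Finset ℕ) : SimpleGraph ℕ := SimpleGraph.fromRel fun x y => ∃ s ∈ S, s + x = y

open Classical in
/-- Deleting vertices from a dense difference graph until the degrees are small removes many
vertices. -/
lemma card_sdiff_of_diffGraph {S F C : Finset ℕ} {d n : ℕ} {δ : ℝ} (hS : 0 ∉ S) (hne : S.Nonempty)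
    (hCn : #C ≤ n) (hdeg : ∀ v ∈ C, #(C.filter ((diffGraph S).Adj v)) < d + 1)
    (hS' : ∀ s ∈ S, δ / 2 * n ≤ #(F.filter fun y => s + y ∈ F))
    (hd : 4 * (d + 1 : ℝ) ≤ δ * #S) :
    δ / 8 * n ≤ #(F \ C) := by
  set E : Finset ℕ → Finset (ℕ × ℕ) := fun X => (S ×ˢ X).filter fun p => p.1 + p.2 ∈ X with hE
  have hEF : (#S : ℝ) * (δ / 2 * n) ≤ #(E F) := by
    have e : #(E F) = ∑ s ∈ S, #(F.filter fun y => s + y ∈ F) := by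
      simp only [hE, card_filter, sum_product]
    rw [e, Nat.cast_sum, ← nsmul_eq_mul]
    exact card_nsmul_le_sum _ _ _ hS'
  have hEC : #(E C) ≤ #C * d := by
    have h1 : #(E C) ≤ #(C.sigma fun v => C.filter ((diffGraph S).Adj v)) := by
      refine card_le_card_of_injOn (fun p => ⟨p.2, p.1 + p.2⟩) ?_ ?_
      · rintro ⟨s, y⟩ hp
        simp only [hE, coe_filter, mem_product, Set.mem_ofPred_eq] at hp
        simp only [coe_sigma, Set.mem_sigma_iff, mem_coe, mem_filter]
        refine ⟨hp.1.2, hp.2, ?_⟩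
        rw [diffGraph, SimpleGraph.fromRel_adj]
        refine ⟨?_, Or.inl ⟨s, hp.1.1, rfl⟩⟩
        have : s ≠ 0 := fun h => hS (h ▸ hp.1.1)
        omega
      · rintro ⟨s, y⟩ _ ⟨s', y'⟩ _ h
        simp only [Sigma.mk.injEq, heq_eq_eq] at h
        obtain ⟨rfl, h⟩ := h
        simpa using h
    refine h1.trans ?_
    rw [card_sigma, ← smul_eq_mul]
    exact sum_le_card_nsmul _ _ _ fun v hv => Nat.lt_succ_iff.1 (hdeg v hv)
  have hsplit : #(E F) ≤ #(E C) + (#S * #(F \ C) + #S * #(F \ C)) := by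
    have hsub : E F ⊆ E C ∪ (S ×ˢ (F \ C) ∪
        (S ×ˢ (F \ C)).image fun p => (p.1, p.2 - p.1)) := by
      rintro ⟨s, y⟩ hp
      simp only [hE, mem_filter, mem_product] at hp
      simp only [hE, mem_union, mem_filter, mem_product, mem_image, mem_sdiff, Prod.exists,
        Prod.mk.injEq]
      by_cases h1 : y ∈ C
      · by_cases h2 : s + y ∈ C
        · exact Or.inl ⟨⟨hp.1.1, h1⟩, h2⟩
        · exact Or.inr (Or.inr ⟨s, s + y, ⟨hp.1.1, hp.2, h2⟩, rfl, by omega⟩)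
      · exact Or.inr (Or.inl ⟨hp.1.1, hp.1.2, h1⟩)
    refine (card_le_card hsub).trans ((card_union_le _ _).trans (Nat.add_le_add_left
      ((card_union_le _ _).trans (Nat.add_le_add ?_ (card_image_le.trans ?_))) _))
    · rw [card_product]
    · rw [card_product]
  have hs : (0 : ℝ) < #S := by exact_mod_cast hne.card_pos
  have h1 : (#(E F) : ℝ) ≤ #C * d + (#S * #(F \ C) + #S * #(F \ C)) := by
    exact_mod_cast hsplit.trans (Nat.add_le_add_right hEC _)
  have h2 : (#C : ℝ) ≤ n := by exact_mod_cast hCn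
  have h3 : (#C : ℝ) * d ≤ n * (δ * #S / 4) := by
    have : (d : ℝ) ≤ δ * #S / 4 := by linarith
    exact mul_le_mul h2 this (by positivity) (by positivity)
  have h4 : (#S : ℝ) * (δ / 8 * n) ≤ #S * #(F \ C) := by nlinarith
  exact le_of_mul_le_mul_left h4 hs

lemma SumFree.mono {A B : Finset ℕ} (h : SumFree B) (hAB : A ⊆ B) : SumFree A :=
  fun x hx y hy hxy => h x (hAB hx) y (hAB hy) (hAB hxy)

lemma SumFree.zero_notMem {A : Finset ℕ} (h : SumFree A) : 0 ∉ A := fun h0 => h 0 h0 0 h0 h0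

open Classical in
/-- A set with many Schur triples can be shrunk to one of a few smaller sets, which between them
almost contain all its sum-free subsets. -/
theorem exists_shrinking_family {δ η : ℝ} (hδ : 0 < δ) (hη : 0 < η) :
    ∃ N : ℕ, ∀ n ≥ N, ∀ F ⊆ Icc 1 n, δ * n ^ 2 ≤ #(schurPairs F) →
      ∃ 𝓖 : Finset (Finset ℕ), (#𝓖 : ℝ) ≤ 2 ^ (η * n) ∧
        (∀ G ∈ 𝓖, G ⊆ F ∧ (#G : ℝ) ≤ #F - δ / 8 * n) ∧
        ∀ I ⊆ F, SumFree I → ∃ G ∈ 𝓖, (#(I \ G) : ℝ) ≤ η * n := by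
  obtain ⟨γ₀, hγ₀, hcount⟩ := exists_card_smallSubsets_le (η := η / 3) (by positivity)
  set γ := min γ₀ η with hγdef
  have hγ : 0 < γ := lt_min hγ₀ hη
  obtain ⟨d, hd⟩ := exists_nat_ge (1 / γ)
  obtain ⟨s, hs⟩ := exists_nat_ge (4 * (d + 1) / δ)
  obtain ⟨N₁, hN₁⟩ := exists_nat_ge (s / γ)
  obtain ⟨N₂, hN₂⟩ := exists_nat_ge (3 / η)
  refine ⟨max N₁ (max N₂ 1), fun n hn F hF hTF => ?_⟩
  have hn1 : (s : ℝ) / γ ≤ n := hN₁.trans (by exact_mod_cast (le_max_left _ _).trans hn)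
  have hn2 : (3 : ℝ) / η ≤ n :=
    hN₂.trans (by exact_mod_cast (le_max_left _ _).trans ((le_max_right _ _).trans hn))
  have hn3 : 1 ≤ n := (le_max_right _ _).trans ((le_max_right _ _).trans hn)
  have hn3' : (1 : ℝ) ≤ n := by exact_mod_cast hn3
  have hFn : #F ≤ n := by simpa using card_le_card hF
  rw [div_le_iff₀ hγ] at hn1
  rw [div_le_iff₀ hη] at hn2
  rw [div_le_iff₀ hγ] at hd
  rw [div_le_iff₀ hδ] at hs
  have hs0 : 0 < s := by
    have : (0 : ℝ) < s * δ := lt_of_lt_of_le (by positivity) hs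
    have : (0 : ℝ) < s := by
      by_contra h
      nlinarith
    exact_mod_cast this
  choose C hC hCI using fun S : Finset ℕ => exists_fingerprint (diffGraph S) d F
  set H := F.filter (fun x => δ / 2 * n ≤ #(F.filter fun y => x + y ∈ F)) with hH
  set P := smallSubsets F (γ₀ * n) with hP
  set 𝓖 := (insert (F \ H) ((P ×ˢ P).image fun q => C q.1 q.2)).filter
    (fun G => G ⊆ F ∧ (#G : ℝ) ≤ #F - δ / 8 * n) with h𝓖
  have hγn : γ * n ≤ γ₀ * n := mul_le_mul_of_nonneg_right (min_le_left _ _) (by positivity)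
  have hγn' : γ * n ≤ η * n := mul_le_mul_of_nonneg_right (min_le_right _ _) (by positivity)
  have hHcard : δ / 2 * n ≤ #H := by
    have e : #(schurPairs F) = ∑ x ∈ F, #(F.filter fun y => x + y ∈ F) := by
      simp only [schurPairs, card_filter, sum_product]
    have h1 : (#(schurPairs F) : ℝ) ≤ ∑ x ∈ F, ((if x ∈ H then (n : ℝ) else 0) + δ / 2 * n) := by
      rw [e, Nat.cast_sum]
      refine sum_le_sum fun x hx => ?_
      by_cases hxH : x ∈ H
      · rw [if_pos hxH]
        have : (#(F.filter fun y => x + y ∈ F) : ℝ) ≤ n := by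
          exact_mod_cast (card_filter_le _ _).trans hFn
        have : 0 ≤ δ / 2 * n := by positivity
        linarith
      · rw [if_neg hxH]
        have : ¬ (δ / 2 * n ≤ #(F.filter fun y => x + y ∈ F)) := fun h =>
          hxH (mem_filter.2 ⟨hx, h⟩)
        linarith
    rw [sum_add_distrib, ← sum_filter, sum_const, sum_const, nsmul_eq_mul, nsmul_eq_mul] at h1
    have h2 : F.filter (· ∈ H) = H := by
      rw [filter_mem_eq_inter]; exact inter_eq_right.2 (filter_subset _ _)
    rw [h2] at h1
    have h3 : (#F : ℝ) * (δ / 2 * n) ≤ n * (δ / 2 * n) :=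
      mul_le_mul_of_nonneg_right (by exact_mod_cast hFn) (by positivity)
    have h4 : (n : ℝ) * (δ / 2 * n) ≤ n * #H := by nlinarith
    exact le_of_mul_le_mul_left h4 (by linarith)
  refine ⟨𝓖, ?_, fun G hG => (mem_filter.1 hG).2, fun I hI hIsf => ?_⟩
  · have h1 : #𝓖 ≤ #P * #P + 1 := by
      refine (card_filter_le _ _).trans ((card_insert_le _ _).trans ?_)
      refine Nat.add_le_add_right (card_image_le.trans ?_) _
      rw [card_product]
    have h2 : (#P : ℝ) ≤ 2 ^ (η / 3 * n) := hcount n F hFn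
    have h3 : (1 : ℝ) ≤ 2 ^ (η / 3 * n) := Real.one_le_rpow (by norm_num) (by positivity)
    have h4 : (2 : ℝ) ≤ 2 ^ (η / 3 * n) := by
      calc (2 : ℝ) = 2 ^ (1 : ℝ) := by simp
        _ ≤ _ := Real.rpow_le_rpow_of_exponent_le (by norm_num) (by linarith)
    have h5 : (2 : ℝ) ^ (η * n) = 2 ^ (η / 3 * n) * 2 ^ (η / 3 * n) * 2 ^ (η / 3 * n) := by
      rw [← Real.rpow_add (by norm_num), ← Real.rpow_add (by norm_num)]; congr 1; ring
    have h6 : (#𝓖 : ℝ) ≤ #P * #P + 1 := by exact_mod_cast h1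
    have h7 : (#P : ℝ) * #P ≤ 2 ^ (η / 3 * n) * 2 ^ (η / 3 * n) :=
      mul_le_mul h2 h2 (by positivity) (by positivity)
    rw [h5]
    nlinarith
  · by_cases hIH : s ≤ #(I ∩ H)
    · obtain ⟨S, hSI, hScard⟩ := exists_subset_card_eq hIH
      have hSI' : S ⊆ I := hSI.trans inter_subset_left
      have hSH : S ⊆ H := hSI.trans inter_subset_right
      obtain ⟨T, hTI, hT, hIT, -⟩ := hCI S I hI (by
        intro u hu v hv huv
        rw [diffGraph, SimpleGraph.fromRel_adj] at huv
        rcases huv.2 with ⟨x, hx, h⟩ | ⟨x, hx, h⟩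
        · exact hIsf x (hSI' hx) u hu (h ▸ hv)
        · exact hIsf x (hSI' hx) v hv (h ▸ hu))
      have hTγ : (#T : ℝ) ≤ γ * n := by
        have h1 : ((d : ℝ) + 1) * #T ≤ n := by exact_mod_cast hT.trans hFn
        have h2 : (#T : ℝ) * 1 ≤ #T * (d * γ) := mul_le_mul_of_nonneg_left hd (by positivity)
        have h3 : (0 : ℝ) ≤ #T := by positivity
        nlinarith
      have hSP : S ∈ P := mem_smallSubsets.2 ⟨hSI'.trans hI, by rw [hScard]; linarith⟩
      have hTP : T ∈ P := mem_smallSubsets.2 ⟨hTI.trans hI, hTγ.trans hγn⟩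
      refine ⟨C S T, mem_filter.2 ⟨mem_insert_of_mem (mem_image.2 ⟨(S, T),
        mem_product.2 ⟨hSP, hTP⟩, rfl⟩), (hC S T).1, ?_⟩, ?_⟩
      · have h1 := card_sdiff_of_diffGraph (S := S) (F := F) (C := C S T) (d := d) (n := n)
          (δ := δ) (fun h => hIsf.zero_notMem (hSI' h)) (card_pos.1 (by omega))
          ((card_le_card (hC S T).1).trans hFn) (hC S T).2
          (fun x hx => (mem_filter.1 (hSH hx)).2) (by rw [hScard]; linarith)
        have h2 : (#(F \ C S T) : ℝ) + #(C S T) = #F := by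
          exact_mod_cast card_sdiff_add_card_eq_card (hC S T).1
        linarith
      · refine le_trans ?_ (hTγ.trans hγn')
        have : I \ C S T ⊆ T := by
          intro x hx
          rcases mem_union.1 (hIT (mem_sdiff.1 hx).1) with h | h
          · exact h
          · exact absurd h (mem_sdiff.1 hx).2
        exact_mod_cast card_le_card this
    · refine ⟨F \ H, mem_filter.2 ⟨mem_insert_self _ _, sdiff_subset, ?_⟩, ?_⟩
      · have h2 : (#(F \ H) : ℝ) + #H = #F := by
          exact_mod_cast card_sdiff_add_card_eq_card (filter_subset _ _)
        have : 0 ≤ δ * n := by positivity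
        linarith
      · have h1 : I \ (F \ H) ⊆ I ∩ H := by
          intro x hx
          simp only [mem_sdiff, not_and, not_not] at hx
          exact mem_inter.2 ⟨hx.1, hx.2 (hI hx.1)⟩
        have h2 : #(I \ (F \ H)) ≤ s := (card_le_card h1).trans (by omega)
        have h3 : (#(I \ (F \ H)) : ℝ) ≤ s := by exact_mod_cast h2
        linarith

open Classical in
lemma exists_container_family_of_card_le {δ η : ℝ} (hδ : 0 < δ) (hη : 0 < η) :
    ∃ N : ℕ, ∀ n ≥ N, ∀ k : ℕ, ∀ F ⊆ Icc 1 n, (#F : ℝ) ≤ k * (δ / 8 * n) →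
      ∃ 𝓖 : Finset (Finset ℕ), (#𝓖 : ℝ) ≤ 2 ^ (k * (η * n)) ∧
        (∀ G ∈ 𝓖, G ⊆ F ∧ (#(schurPairs G) : ℝ) < δ * n ^ 2) ∧
        ∀ I ⊆ F, SumFree I → ∃ G ∈ 𝓖, (#(I \ G) : ℝ) ≤ k * (η * n) := by
  obtain ⟨N, hN⟩ := exists_shrinking_family hδ hη
  refine ⟨max N 1, fun n hn k => ?_⟩
  have hn1 : (1 : ℝ) ≤ n := by exact_mod_cast (le_max_right _ _).trans hn
  induction k with
  | zero =>
    intro F hF hFc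
    have hF0 : F = ∅ := by
      rw [← card_eq_zero]
      have : (#F : ℝ) ≤ 0 := by simpa using hFc
      exact_mod_cast le_antisymm this (by positivity)
    subst hF0
    refine ⟨{∅}, by simp, ?_, ?_⟩
    · intro G hG
      rw [mem_singleton.1 hG]
      refine ⟨Subset.rfl, ?_⟩
      simp only [schurPairs, empty_product, filter_empty, card_empty, Nat.cast_zero]
      positivity
    · intro I hI _
      exact ⟨∅, mem_singleton_self _, by simp [subset_empty.1 hI]⟩
  | succ k ih =>
    intro F hF hFc
    have hpos : 0 ≤ η * n := by positivity
    by_cases hT : δ * n ^ 2 ≤ #(schurPairs F)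
    · obtain ⟨𝓖, h1, h2, h3⟩ := hN n ((le_max_left _ _).trans hn) F hF hT
      have hih : ∀ G ∈ 𝓖, ∃ 𝓗 : Finset (Finset ℕ), (#𝓗 : ℝ) ≤ 2 ^ (k * (η * n)) ∧
          (∀ G' ∈ 𝓗, G' ⊆ G ∧ (#(schurPairs G') : ℝ) < δ * n ^ 2) ∧
          ∀ I ⊆ G, SumFree I → ∃ G' ∈ 𝓗, (#(I \ G') : ℝ) ≤ k * (η * n) := by
        intro G hG
        refine ih G ((h2 G hG).1.trans hF) ?_
        have := (h2 G hG).2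
        push_cast at hFc
        linarith
      choose! 𝓗 a1 a2 a3 using hih
      refine ⟨𝓖.biUnion 𝓗, ?_, ?_, ?_⟩
      · have e : (#(𝓖.biUnion 𝓗) : ℝ) ≤ ∑ G ∈ 𝓖, (#(𝓗 G) : ℝ) := by
          exact_mod_cast card_biUnion_le
        refine e.trans ((sum_le_sum a1).trans ?_)
        rw [sum_const, nsmul_eq_mul]
        calc (#𝓖 : ℝ) * 2 ^ (k * (η * n)) ≤ 2 ^ (η * n) * 2 ^ (k * (η * n)) :=
              mul_le_mul_of_nonneg_right h1 (by positivity)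
          _ = _ := by
              rw [← Real.rpow_add (by norm_num)]; congr 1; push_cast; ring
      · intro G' hG'
        obtain ⟨G, hG, hG'⟩ := mem_biUnion.1 hG'
        exact ⟨(a2 G hG G' hG').1.trans (h2 G hG).1, (a2 G hG G' hG').2⟩
      · intro I hI hIsf
        obtain ⟨G, hG, hGI⟩ := h3 I hI hIsf
        obtain ⟨G', hG', hGI'⟩ := a3 G hG (I ∩ G) inter_subset_right (hIsf.mono inter_subset_left)
        refine ⟨G', mem_biUnion.2 ⟨G, hG, hG'⟩, ?_⟩
        have hsub : I \ G' ⊆ (I \ G) ∪ ((I ∩ G) \ G') := by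
          intro x hx
          simp only [mem_sdiff, mem_union, mem_inter] at hx ⊢
          tauto
        have : (#(I \ G') : ℝ) ≤ #(I \ G) + #((I ∩ G) \ G') := by
          exact_mod_cast (card_le_card hsub).trans (card_union_le _ _)
        push_cast
        linarith
    · refine ⟨{F}, ?_, ?_, ?_⟩
      · rw [card_singleton, Nat.cast_one]
        exact Real.one_le_rpow (by norm_num) (by positivity)
      · intro G hG
        rw [mem_singleton.1 hG]
        exact ⟨Subset.rfl, by linarith⟩
      · intro I hI _
        refine ⟨F, mem_singleton_self _, ?_⟩
        rw [sdiff_eq_empty_iff_subset.2 hI]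
        simp only [card_empty, Nat.cast_zero]
        positivity

/-- Containers for sum-free sets: a family of `2 ^ o(n)` sets with `o(n ^ 2)` Schur triples almost
containing all sum-free subsets of `[n]`. -/
theorem exists_container_family {δ η : ℝ} (hδ : 0 < δ) (hη : 0 < η) :
    ∃ N : ℕ, ∀ n ≥ N, ∃ 𝓖 : Finset (Finset ℕ), (#𝓖 : ℝ) ≤ 2 ^ (η * n) ∧
      (∀ G ∈ 𝓖, G ⊆ Icc 1 n ∧ (#(schurPairs G) : ℝ) < δ * n ^ 2) ∧
      ∀ I ⊆ Icc 1 n, SumFree I → ∃ G ∈ 𝓖, (#(I \ G) : ℝ) ≤ η * n := by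
  obtain ⟨k, hk⟩ := exists_nat_ge (8 / δ)
  rw [div_le_iff₀ hδ] at hk
  have hk0 : (0 : ℝ) < k := by
    by_contra h
    nlinarith
  obtain ⟨N, hN⟩ := exists_container_family_of_card_le hδ (η := η / k) (by positivity)
  refine ⟨N, fun n hn => ?_⟩
  have h := hN n hn k (Icc 1 n) Subset.rfl (by
    simp only [Nat.card_Icc, add_tsub_cancel_right]
    have : (0 : ℝ) ≤ n := by positivity
    nlinarith)
  have e : k * (η / k * n) = η * n := by field_simp
  rw [e] at h
  exact h

/-- The tripartite graph whose triangles encode the Schur triples of `A`, up to translation. -/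
def schurGraph (n : ℕ) (A : Finset ℕ) : SimpleGraph (Fin 3 × Fin (2 * n)) :=
  SimpleGraph.fromRel fun p q => p.1 < q.1 ∧ ∃ a ∈ A, (p.2 : ℕ) + a = q.2

lemma schurGraph_adj {n : ℕ} {A : Finset ℕ} {p q : Fin 3 × Fin (2 * n)} (hpq : p.1 < q.1) :
    (schurGraph n A).Adj p q ↔ ∃ a ∈ A, (p.2 : ℕ) + a = q.2 := by
  rw [schurGraph, SimpleGraph.fromRel_adj]
  constructor
  · rintro ⟨-, h | h⟩
    · exact h.2
    · exact absurd h.1 hpq.not_gt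
  · intro h
    exact ⟨fun e => hpq.ne (congrArg Prod.fst e), Or.inl ⟨hpq, h⟩⟩

lemma schurGraph_fst_ne {n : ℕ} {A : Finset ℕ} {p q : Fin 3 × Fin (2 * n)}
    (h : (schurGraph n A).Adj p q) : p.1 ≠ q.1 := by
  rw [schurGraph, SimpleGraph.fromRel_adj] at h
  rcases h.2 with h | h
  · exact h.1.ne
  · exact h.1.ne'

open Classical in
lemma card_cliqueFinset_schurGraph_le (n : ℕ) (A : Finset ℕ) :
    #((schurGraph n A).cliqueFinset 3) ≤ 2 * n * #(schurPairs A) := by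
  set Φ : Fin (2 * n) × ℕ × ℕ → Finset (Fin 3 × Fin (2 * n)) := fun t =>
    univ.filter fun v => (v.1 = 0 ∧ (v.2 : ℕ) = t.1) ∨ (v.1 = 1 ∧ (v.2 : ℕ) = t.1 + t.2.1) ∨
      (v.1 = 2 ∧ (v.2 : ℕ) = t.1 + (t.2.1 + t.2.2)) with hΦ
  have key : ∀ p q r : Fin 3 × Fin (2 * n), (schurGraph n A).Adj p q → (schurGraph n A).Adj q r →
      (schurGraph n A).Adj p r → p.1 < q.1 → q.1 < r.1 →
      ({p, q, r} : Finset _) ∈ (univ ×ˢ schurPairs A).image Φ := by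
    intro p q r hpq hqr hpr h1 h2
    obtain ⟨a, ha, e1⟩ := (schurGraph_adj h1).1 hpq
    obtain ⟨b, hb, e2⟩ := (schurGraph_adj h2).1 hqr
    obtain ⟨c, hc, e3⟩ := (schurGraph_adj (h1.trans h2)).1 hpr
    have hab : a + b = c := by omega
    refine mem_image.2 ⟨(p.2, a, b), mem_product.2 ⟨mem_univ _, ?_⟩, ?_⟩
    · simp only [schurPairs, mem_filter, mem_product]
      exact ⟨⟨ha, hb⟩, hab ▸ hc⟩
    · ext v
      simp only [hΦ, mem_filter, mem_univ, true_and, mem_insert, mem_singleton, Prod.ext_iff,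
        Fin.ext_iff]
      have := p.1.isLt
      have := q.1.isLt
      have := r.1.isLt
      rw [Fin.lt_def] at h1 h2
      have f0 : ((0 : Fin 3) : ℕ) = 0 := rfl
      have f1 : ((1 : Fin 3) : ℕ) = 1 := rfl
      have f2 : ((2 : Fin 3) : ℕ) = 2 := rfl
      omega
  have hsub : (schurGraph n A).cliqueFinset 3 ⊆ (univ ×ˢ schurPairs A).image Φ := by
    intro s hs
    rw [SimpleGraph.mem_cliqueFinset_iff, SimpleGraph.is3Clique_iff] at hs
    obtain ⟨p, q, r, hpq, hpr, hqr, rfl⟩ := hs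
    have n1 := schurGraph_fst_ne hpq
    have n2 := schurGraph_fst_ne hpr
    have n3 := schurGraph_fst_ne hqr
    rcases lt_or_gt_of_ne n1 with h1 | h1 <;> rcases lt_or_gt_of_ne n2 with h2 | h2 <;>
      rcases lt_or_gt_of_ne n3 with h3 | h3
    · exact key p q r hpq hqr hpr h1 h3
    · have := key p r q hpr hqr.symm hpq h2 h3
      rwa [show ({p, q, r} : Finset _) = {p, r, q} by ext; simp; tauto]
    · exact absurd (h1.trans h3) h2.not_gt
    · have := key r p q hpr.symm hpq hqr.symm h2 h1
      rwa [show ({p, q, r} : Finset _) = {r, p, q} by ext; simp; tauto]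
    · have := key q p r hpq.symm hpr hqr h1 h2
      rwa [show ({p, q, r} : Finset _) = {q, p, r} by ext; simp; tauto]
    · exact absurd (h3.trans h1) h2.not_gt
    · have := key q r p hqr hpr.symm hpq.symm h3 h2
      rwa [show ({p, q, r} : Finset _) = {q, r, p} by ext; simp; tauto]
    · have := key r q p hqr.symm hpq.symm hpr.symm h3 h1
      rwa [show ({p, q, r} : Finset _) = {r, q, p} by ext; simp; tauto]
  refine (card_le_card hsub).trans (card_image_le.trans ?_)
  rw [card_product, card_univ, Fintype.card_fin]

open Classical in
/-- Green's removal lemma for Schur triples: a subset of `[n]` with few Schur triples can be made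
sum-free by removing few elements. -/
theorem exists_sumFree_subset_of_few_schurPairs {η : ℝ} (hη : 0 < η) :
    ∃ δ : ℝ, 0 < δ ∧ ∀ n ≥ 1, ∀ A ⊆ Icc 1 n, (#(schurPairs A) : ℝ) < δ * n ^ 2 →
      ∃ B ⊆ A, SumFree B ∧ (#(A \ B) : ℝ) ≤ η * n := by
  set ε := η / 108 with hε
  have hε0 : 0 < ε := by positivity
  have hτ := SimpleGraph.triangleRemovalBound_pos hε0
  refine ⟨108 * SimpleGraph.triangleRemovalBound ε, by positivity, fun n hn A hA hT => ?_⟩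
  have hn0 : (0 : ℝ) < n := by exact_mod_cast hn
  have hcardV : Fintype.card (Fin 3 × Fin (2 * n)) = 6 * n := by
    rw [Fintype.card_prod, Fintype.card_fin, Fintype.card_fin]; ring
  have hclique : (#((schurGraph n A).cliqueFinset 3) : ℝ) <
      SimpleGraph.triangleRemovalBound ε * Fintype.card (Fin 3 × Fin (2 * n)) ^ 3 := by
    have h1 : (#((schurGraph n A).cliqueFinset 3) : ℝ) ≤ 2 * n * #(schurPairs A) := by
      exact_mod_cast card_cliqueFinset_schurGraph_le n A
    have h2 : 2 * (n : ℝ) * #(schurPairs A) <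
        2 * n * (108 * SimpleGraph.triangleRemovalBound ε * n ^ 2) :=
      mul_lt_mul_of_pos_left hT (by positivity)
    rw [hcardV]
    push_cast
    nlinarith
  obtain ⟨G', hG'le, _, hmiss, hfree⟩ := SimpleGraph.triangle_removal hclique
  set m : ℕ → Finset ((Fin 3 × Fin (2 * n)) × (Fin 3 × Fin (2 * n))) := fun a =>
    univ.filter fun t => t.1.1 < t.2.1 ∧ (t.1.2 : ℕ) + a = t.2.2 ∧
      (schurGraph n A).Adj t.1 t.2 ∧ ¬ G'.Adj t.1 t.2 with hm
  have hmsum : ∑ a ∈ A, #(m a) ≤ #(schurGraph n A).edgeFinset - #G'.edgeFinset := by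
    rw [← card_sdiff_of_subset (SimpleGraph.edgeFinset_mono hG'le), ← card_biUnion]
    · refine card_le_card_of_injOn (fun t => s(t.1, t.2)) ?_ ?_
      · intro t ht
        simp only [coe_biUnion, Set.mem_iUnion, mem_coe, hm, mem_filter, mem_univ, true_and] at ht
        obtain ⟨a, ha, h1, h2, h3, h4⟩ := ht
        simp only [mem_coe, mem_sdiff, SimpleGraph.mem_edgeFinset, SimpleGraph.mem_edgeSet]
        exact ⟨h3, h4⟩
      · intro t ht t' ht' h
        simp only [coe_biUnion, Set.mem_iUnion, mem_coe, hm, mem_filter, mem_univ, true_and]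
          at ht ht'
        obtain ⟨a, -, h1, -⟩ := ht
        obtain ⟨a', -, h1', -⟩ := ht'
        simp only [Sym2.eq_iff] at h
        rcases h with h | h
        · exact Prod.ext h.1 h.2
        · rw [h.1, h.2] at h1
          exact absurd h1 h1'.not_gt
    · intro a _ b _ hab
      refine disjoint_left.2 fun t hta htb => hab ?_
      simp only [hm, mem_filter, mem_univ, true_and] at hta htb
      omega
  refine ⟨A.filter fun a => 3 * #(m a) < n, filter_subset _ _, ?_, ?_⟩
  · intro a ha b hb hc
    rw [mem_filter] at ha hb hc
    obtain ⟨hab, hc3⟩ := hc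
    have hcover : range n ⊆ (m a).image (fun t => (t.1.2 : ℕ)) ∪
        ((m b).image (fun t => (t.1.2 : ℕ) - a) ∪ (m (a + b)).image (fun t => (t.1.2 : ℕ))) := by
      intro x hx
      rw [mem_range] at hx
      have hcn := (mem_Icc.1 (hA hab)).2
      set p : Fin 3 × Fin (2 * n) := (0, ⟨x, by omega⟩) with hp
      set q : Fin 3 × Fin (2 * n) := (1, ⟨x + a, by omega⟩) with hq
      set r : Fin 3 × Fin (2 * n) := (2, ⟨x + a + b, by omega⟩) with hr
      have h01 : p.1 < q.1 := show (0 : Fin 3) < 1 by decide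
      have h12 : q.1 < r.1 := show (1 : Fin 3) < 2 by decide
      have e1 : (schurGraph n A).Adj p q := (schurGraph_adj h01).2 ⟨a, ha.1, rfl⟩
      have e2 : (schurGraph n A).Adj q r := (schurGraph_adj h12).2 ⟨b, hb.1, rfl⟩
      have e3 : (schurGraph n A).Adj p r := (schurGraph_adj (h01.trans h12)).2
        ⟨a + b, hab, (add_assoc _ _ _).symm⟩
      have hnot : ¬ (G'.Adj p q ∧ G'.Adj p r ∧ G'.Adj q r) := fun h =>
        hfree {p, q, r} (SimpleGraph.is3Clique_triple_iff.2 h)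
      simp only [mem_union, mem_image]
      by_cases g1 : G'.Adj p q
      · by_cases g2 : G'.Adj q r
        · refine Or.inr (Or.inr ⟨(p, r), ?_, rfl⟩)
          simp only [hm, mem_filter, mem_univ, true_and]
          exact ⟨h01.trans h12, (add_assoc _ _ _).symm, e3, fun g3 => hnot ⟨g1, g3, g2⟩⟩
        · refine Or.inr (Or.inl ⟨(q, r), ?_, Nat.add_sub_cancel _ _⟩)
          simp only [hm, mem_filter, mem_univ, true_and]
          exact ⟨h12, rfl, e2, g2⟩
      · refine Or.inl ⟨(p, q), ?_, rfl⟩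
        simp only [hm, mem_filter, mem_univ, true_and]
        exact ⟨h01, rfl, e1, g1⟩
    have h1 := (card_le_card hcover).trans ((card_union_le _ _).trans (Nat.add_le_add card_image_le
      ((card_union_le _ _).trans (Nat.add_le_add card_image_le card_image_le))))
    rw [card_range] at h1
    omega
  · set D := A \ A.filter fun a => 3 * #(m a) < n with hD
    have h1 : #D * n ≤ 3 * ∑ a ∈ A, #(m a) := by
      rw [mul_sum, ← smul_eq_mul]
      refine (card_nsmul_le_sum D (fun a => 3 * #(m a)) n ?_).trans
        (sum_le_sum_of_subset sdiff_subset)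
      intro a ha
      simp only [hD, mem_sdiff, mem_filter, not_and, not_lt] at ha
      exact ha.2 ha.1
    have h2 : #G'.edgeFinset ≤ #(schurGraph n A).edgeFinset :=
      card_le_card (SimpleGraph.edgeFinset_mono hG'le)
    have h3 : (#D : ℝ) * n ≤ 3 * (#(schurGraph n A).edgeFinset - #G'.edgeFinset) := by
      rw [← Nat.cast_sub h2]
      exact_mod_cast h1.trans (Nat.mul_le_mul_left 3 hmsum)
    rw [hcardV] at hmiss
    push_cast at hmiss
    have h4 : (#D : ℝ) * n ≤ η * n * n := by
      have : ε * (6 * (n : ℝ)) ^ 2 = η / 3 * n * n := by rw [hε]; ring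
      linarith
    exact le_of_mul_le_mul_right h4 hn0

open Classical in
/-- A family of `2 ^ o(n)` sum-free sets which almost contain all sum-free subsets of `[n]`. -/
theorem exists_sumFree_container_family {η : ℝ} (hη : 0 < η) :
    ∃ N : ℕ, ∀ n ≥ N, ∃ 𝓑 : Finset (Finset ℕ), (#𝓑 : ℝ) ≤ 2 ^ (η * n) ∧
      (∀ B ∈ 𝓑, B ⊆ Icc 1 n ∧ SumFree B) ∧
      ∀ I ⊆ Icc 1 n, SumFree I → ∃ B ∈ 𝓑, (#(I \ B) : ℝ) ≤ η * n := by
  obtain ⟨δ, hδ, hrem⟩ := exists_sumFree_subset_of_few_schurPairs (η := η / 2) (by positivity)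
  obtain ⟨N, hN⟩ := exists_container_family hδ (η := η / 2) (by positivity)
  refine ⟨max N 1, fun n hn => ?_⟩
  obtain ⟨𝓖, h1, h2, h3⟩ := hN n ((le_max_left _ _).trans hn)
  have hr : ∀ G ∈ 𝓖, ∃ B ⊆ G, SumFree B ∧ (#(G \ B) : ℝ) ≤ η / 2 * n := fun G hG =>
    hrem n ((le_max_right _ _).trans hn) G (h2 G hG).1 (h2 G hG).2
  choose! b hb1 hb2 hb3 using hr
  refine ⟨𝓖.image b, ?_, ?_, ?_⟩
  · have e : (#(𝓖.image b) : ℝ) ≤ #𝓖 := by exact_mod_cast card_image_le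
    refine e.trans (h1.trans (Real.rpow_le_rpow_of_exponent_le (by norm_num) ?_))
    exact mul_le_mul_of_nonneg_right (by linarith) (by positivity)
  · intro B hB
    obtain ⟨G, hG, rfl⟩ := mem_image.1 hB
    exact ⟨(hb1 G hG).trans (h2 G hG).1, hb2 G hG⟩
  · intro I hI hIsf
    obtain ⟨G, hG, hGI⟩ := h3 I hI hIsf
    refine ⟨b G, mem_image_of_mem _ hG, ?_⟩
    have hsub : I \ b G ⊆ (I \ G) ∪ (G \ b G) := by
      intro x hx
      simp only [mem_sdiff, mem_union] at hx ⊢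
      tauto
    have : (#(I \ b G) : ℝ) ≤ #(I \ G) + #(G \ b G) := by
      exact_mod_cast (card_le_card hsub).trans (card_union_le _ _)
    have := hb3 G hG
    linarith

open scoped Pointwise in
/-- A set whose difference set is less than one and a half times as large has a difference set
closed under addition. -/
lemma add_mem_sub_of_two_mul_card_lt {α : Type*} [AddCommGroup α] [DecidableEq α] {A : Finset α}
    (h : 2 * #(A - A) < 3 * #A) {x y : α} (hx : x ∈ A - A) (hy : y ∈ A - A) : x + y ∈ A - A := by
  have hpop : ∀ z ∈ A - A, #A < 2 * #(A.filter fun c => c + z ∈ A) := by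
    intro z hz
    obtain ⟨a, ha, b, hb, rfl⟩ := mem_sub.1 hz
    set U := A.image fun c => a - c with hU
    set W := A.image fun c => b - c with hW
    have hUs : U ⊆ A - A := by
      intro u hu
      obtain ⟨c, hc, rfl⟩ := mem_image.1 hu
      exact sub_mem_sub ha hc
    have hWs : W ⊆ A - A := by
      intro u hu
      obtain ⟨c, hc, rfl⟩ := mem_image.1 hu
      exact sub_mem_sub hb hc
    have hUc : #U = #A := card_image_of_injective _ sub_right_injective
    have hWc : #W = #A := card_image_of_injective _ sub_right_injective
    have h1 := card_union_add_card_inter U W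
    have h2 := card_le_card (union_subset hUs hWs)
    have h3 : #(U ∩ W) ≤ #(A.filter fun c => c + (a - b) ∈ A) := by
      refine card_le_card_of_injOn (fun u => b - u) ?_ sub_right_injective.injOn
      intro u hu
      obtain ⟨hu1, hu2⟩ := mem_inter.1 (mem_coe.1 hu)
      obtain ⟨c, hc, rfl⟩ := mem_image.1 hu1
      obtain ⟨c', hc', e⟩ := mem_image.1 hu2
      simp only [coe_filter, Set.mem_ofPred_eq]
      refine ⟨?_, ?_⟩
      · have : b - (a - c) = c' := by rw [← e]; abel
        rwa [this]
      · have : b - (a - c) + (a - b) = c := by abel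
        rwa [this]
    omega
  have hpos : x ∈ A - A := hx
  have hnx : -x ∈ A - A := by
    obtain ⟨a, ha, b, hb, rfl⟩ := mem_sub.1 hx
    rw [neg_sub]
    exact sub_mem_sub hb ha
  have h1 := hpop _ hnx
  have h2 := hpop _ hy
  have h3 := card_union_add_card_inter (A.filter fun c => c + -x ∈ A) (A.filter fun c => c + y ∈ A)
  have h4 := card_le_card (union_subset (filter_subset (fun c => c + -x ∈ A) A)
    (filter_subset (fun c => c + y ∈ A) A))
  obtain ⟨c, hc⟩ := card_pos.1 (show
    0 < #((A.filter fun c => c + -x ∈ A) ∩ (A.filter fun c => c + y ∈ A)) by omega)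
  obtain ⟨hc1, hc2⟩ := mem_inter.1 hc
  have := sub_mem_sub (mem_filter.1 hc2).2 (mem_filter.1 hc1).2
  have e : c + y - (c + -x) = x + y := by abel
  rwa [e] at this

lemma SumFree.card_le_min {B : Finset ℕ} {m n : ℕ} (hB : SumFree B) (hm : m ∈ B)
    (hmin : ∀ b ∈ B, m ≤ b) (hmax : ∀ b ∈ B, b ≤ n) (hn : n < 3 * m) : #B ≤ m := by
  have h : #B ≤ #(Ico m (2 * m)) := by
    refine card_le_card_of_injOn (fun b => if b < 2 * m then b else b - m) ?_ ?_
    · intro b hb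
      have := hmin b hb
      have := hmax b hb
      rw [mem_coe, mem_Ico]
      dsimp only
      split_ifs <;> omega
    · intro b hb c hc hbc
      have h1 := hmin b hb
      have h2 := hmin c hc
      have h3 : m + b ≠ c := fun e => hB m hm b hb (e ▸ hc)
      have h4 : m + c ≠ b := fun e => hB m hm c hc (e ▸ hb)
      dsimp only at hbc
      split_ifs at hbc <;> omega
  rw [Nat.card_Ico] at h
  omega

open Classical in
lemma SumFree.card_le_of_even {B : Finset ℕ} {n : ℕ} (hB : SumFree B) (hBn : B ⊆ Icc 1 n)
    (he : ∀ b ∈ B, Even b) : 4 * #B ≤ n + 2 := by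
  rcases B.eq_empty_or_nonempty with rfl | hne
  · simp
  set M := B.max' hne with hM
  have hMB : M ∈ B := max'_mem _ _
  have hle : ∀ b ∈ B, b ≤ M := fun b hb => le_max' _ _ hb
  set B' := (B.erase M).image fun b => M - b with hB'
  have hB'c : #B' = #B - 1 := by
    rw [hB', card_image_of_injOn, card_erase_of_mem hMB]
    intro a ha b hb hab
    have := hle a (mem_erase.1 ha).2
    have := hle b (mem_erase.1 hb).2
    dsimp only at hab
    omega
  have hdisj : Disjoint B B' := by
    refine disjoint_left.2 fun x hx hx' => ?_
    obtain ⟨b, hb, rfl⟩ := mem_image.1 hx'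
    have hb' := mem_erase.1 hb
    have := hle b hb'.2
    exact hB b hb'.2 (M - b) hx (by rwa [Nat.add_sub_cancel' this])
  have hsub : B ∪ B' ⊆ (Icc 1 (n / 2)).image fun i => 2 * i := by
    intro x hx
    have hMn := (mem_Icc.1 (hBn hMB)).2
    rcases mem_union.1 hx with h | h
    · obtain ⟨i, hi⟩ := he x h
      have := mem_Icc.1 (hBn h)
      exact mem_image.2 ⟨i, mem_Icc.2 ⟨by omega, by omega⟩, by omega⟩
    · obtain ⟨b, hb, rfl⟩ := mem_image.1 h
      obtain ⟨hbM, hbB⟩ := mem_erase.1 hb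
      obtain ⟨i, hi⟩ := he b hbB
      obtain ⟨j, hj⟩ := he M hMB
      have := hle b hbB
      exact mem_image.2 ⟨j - i, mem_Icc.2 ⟨by omega, by omega⟩, by omega⟩
  have h1 := (card_le_card hsub).trans card_image_le
  rw [card_union_of_disjoint hdisj, Nat.card_Icc, hB'c] at h1
  have := hne.card_pos
  omega

lemma Nat.ModEq.eq_or_eq_add_of_lt {a b l : ℕ} (h : a ≡ b [MOD l]) (ha : a ≤ l) (hb : 0 < b)
    (hbl : b < 2 * l) : b = a ∨ b = a + l := by
  rcases le_total a b with hab | hab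
  · obtain ⟨c, hc⟩ := (Nat.modEq_iff_dvd' hab).1 h
    rcases c with _ | _ | c
    · omega
    · omega
    · have : l * (c + 1 + 1) = l * c + l + l := by ring
      have := Nat.zero_le (l * c)
      omega
  · obtain ⟨c, hc⟩ := (Nat.modEq_iff_dvd' hab).1 h.symm
    rcases c with _ | c
    · omega
    · have : l * (c + 1) = l * c + l := by ring
      have := Nat.zero_le (l * c)
      omega

open Classical in
open scoped Pointwise in
/-- A weak form of Freiman's structure theorem: a sum-free subset of `[n]` with at least `0.46 n`
elements consists of odd numbers or has no element smaller than its cardinality. -/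
theorem SumFree.odd_or_card_le {B : Finset ℕ} {n : ℕ} (hB : SumFree B) (hBn : B ⊆ Icc 1 n)
    (hcard : 46 * n ≤ 100 * #B) (hn : 100 ≤ n) :
    (∀ b ∈ B, Odd b) ∨ ∀ b ∈ B, #B ≤ b := by
  have hne : B.Nonempty := card_pos.1 (by omega)
  set m := B.min' hne with hm
  set M := B.max' hne with hM
  have hmB : m ∈ B := min'_mem _ _
  have hMB : M ∈ B := max'_mem _ _
  have hmle : ∀ b ∈ B, m ≤ b := fun b hb => min'_le _ _ hb
  have hleM : ∀ b ∈ B, b ≤ M := fun b hb => le_max' _ _ hb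
  have hMn := (mem_Icc.1 (hBn hMB)).2
  have hm1 := (mem_Icc.1 (hBn hmB)).1
  have hBsub : B ⊆ Icc m M := fun b hb => mem_Icc.2 ⟨hmle b hb, hleM b hb⟩
  have hkl : #B ≤ M + 1 - m := by simpa using card_le_card hBsub
  obtain ⟨l, hl⟩ : ∃ l, M = m + l := ⟨M - m, by omega⟩
  have hl0 : 0 < l := by omega
  have : NeZero l := ⟨hl0.ne'⟩
  set A : Finset (ZMod l) := B.image fun b => ((b - m : ℕ) : ZMod l) with hA
  have hcast : ∀ a b : ℕ, a < l → b < l → (a : ZMod l) = b → a = b := by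
    intro a b ha hb h
    rw [ZMod.natCast_eq_natCast_iff] at h
    exact Nat.ModEq.eq_of_lt_of_lt h ha hb
  have hAcard : #B - 1 ≤ #A := by
    rw [← card_erase_of_mem hMB]
    refine card_le_card_of_injOn (fun b => ((b - m : ℕ) : ZMod l)) ?_ ?_
    · intro b hb
      exact mem_image_of_mem _ (mem_erase.1 hb).2
    · intro a ha b hb hab
      have ha' := mem_erase.1 ha
      have hb' := mem_erase.1 hb
      have h1 := hleM a ha'.2
      have h2 := hleM b hb'.2
      have h3 := hmle a ha'.2
      have h4 := hmle b hb'.2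
      have := hcast (a - m) (b - m) (by omega) (by omega) hab
      omega
  have h0A : (0 : ZMod l) ∈ A := mem_image.2 ⟨m, hmB, by simp⟩
  set Q := A - A with hQ
  set D := (Icc 1 l).filter fun d => ∃ x ∈ B, x + d ∈ B with hD
  have hBD : #B + #D ≤ M := by
    have hd : Disjoint B D := disjoint_left.2 fun x hx hxD => by
      obtain ⟨-, y, hy, hyx⟩ := mem_filter.1 hxD
      exact hB y hy x hx hyx
    rw [← card_union_of_disjoint hd]
    have : B ∪ D ⊆ Icc 1 M := by
      refine union_subset (fun b hb => mem_Icc.2 ⟨(mem_Icc.1 (hBn hb)).1, hleM b hb⟩) ?_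
      refine (filter_subset _ _).trans (Icc_subset_Icc_right (by omega))
    simpa using card_le_card this
  have hQD : #Q + #B ≤ 2 * #D + 1 := by
    set D₁ := D.erase l with hD₁
    set D₂ := D₁.image fun d => l - d with hD₂
    set Q₁ := (Icc 1 (l - 1)).filter fun t => ((t : ℕ) : ZMod l) ∈ Q with hQ₁
    set B₁ := ((B.erase M).erase m).image fun b => b - m with hB₁
    have hlD : l ∈ D := mem_filter.2 ⟨mem_Icc.2 ⟨hl0, le_rfl⟩, m, hmB, hl ▸ hMB⟩
    have hD₁c : #D₁ = #D - 1 := card_erase_of_mem hlD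
    have hDpos : 0 < #D := card_pos.2 ⟨l, hlD⟩
    have hD₂c : #D₂ ≤ #D₁ := card_image_le
    have hmemD₁ : ∀ d x, 1 ≤ d → d < l → x ∈ B → x + d ∈ B → d ∈ D₁ := fun d x h1 h2 h3 h4 =>
      mem_erase.2 ⟨h2.ne, mem_filter.2 ⟨mem_Icc.2 ⟨h1, h2.le⟩, x, h3, h4⟩⟩
    have hB₁c : #B₁ = #B - 2 := by
      rw [hB₁, card_image_of_injOn, card_erase_of_mem (mem_erase.2 ⟨by omega, hmB⟩),
        card_erase_of_mem hMB]
      · omega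
      · intro a ha b hb hab
        have h3 := hmle a (mem_erase.1 (mem_erase.1 ha).2).2
        have h4 := hmle b (mem_erase.1 (mem_erase.1 hb).2).2
        dsimp only at hab
        omega
    have hB₁s : B₁ ⊆ D₁ ∩ D₂ := by
      intro t ht
      obtain ⟨b, hb, rfl⟩ := mem_image.1 ht
      obtain ⟨hb1, hb2⟩ := mem_erase.1 hb
      obtain ⟨hb3, hb4⟩ := mem_erase.1 hb2
      have h1 := hmle b hb4
      have h2 := hleM b hb4
      refine mem_inter.2 ⟨hmemD₁ _ m (by omega) (by omega) hmB ?_, mem_image.2 ⟨M - b, ?_, ?_⟩⟩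
      · rwa [Nat.add_sub_cancel' h1]
      · refine hmemD₁ _ b (by omega) (by omega) hb4 ?_
        rwa [Nat.add_sub_cancel' h2]
      · omega
    have hQ₁s : Q₁ ⊆ D₁ ∪ D₂ := by
      intro t ht
      obtain ⟨ht1, ht2⟩ := mem_filter.1 ht
      rw [mem_Icc] at ht1
      obtain ⟨a, ha, b, hb, e⟩ := mem_sub.1 ht2
      obtain ⟨x, hx, rfl⟩ := mem_image.1 ha
      obtain ⟨y, hy, rfl⟩ := mem_image.1 hb
      have h1 := hmle x hx
      have h2 := hleM x hx
      have h3 := hmle y hy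
      have h4 := hleM y hy
      have e' : ((t + (y - m) : ℕ) : ZMod l) = ((x - m : ℕ) : ZMod l) := by
        rw [Nat.cast_add, ← e]; abel
      rw [ZMod.natCast_eq_natCast_iff] at e'
      rcases e'.symm.eq_or_eq_add_of_lt (by omega) (by omega) (by omega) with e'' | e''
      · refine mem_union_left _ (hmemD₁ _ y (by omega) (by omega) hy ?_)
        have : y + t = x := by omega
        rwa [this]
      · refine mem_union_right _ (mem_image.2 ⟨l - t, hmemD₁ _ x (by omega) (by omega) hx ?_,
          by omega⟩)
        have : x + (l - t) = y := by omega
        rwa [this]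
    have hQc : #Q ≤ #Q₁ + 1 := by
      have : Q ⊆ insert 0 (Q₁.image fun t => ((t : ℕ) : ZMod l)) := by
        intro q hq
        by_cases hq0 : q = 0
        · simp [hq0]
        · refine mem_insert_of_mem (mem_image.2 ⟨q.val, mem_filter.2 ⟨mem_Icc.2 ⟨?_, ?_⟩, ?_⟩, ?_⟩)
          · exact Nat.pos_of_ne_zero fun h => hq0 ((ZMod.val_eq_zero q).1 h)
          · have := ZMod.val_lt q
            omega
          · rwa [ZMod.natCast_zmod_val]
          · rw [ZMod.natCast_zmod_val]
      exact (card_le_card this).trans ((card_insert_le _ _).trans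
        (Nat.add_le_add_right card_image_le _))
    have h1 := card_union_add_card_inter D₁ D₂
    have h2 := card_le_card hB₁s
    have h3 := card_le_card hQ₁s
    omega
  have hsmall : 2 * #Q < 3 * #A := by omega
  have hadd : ∀ x ∈ Q, ∀ y ∈ Q, x + y ∈ Q := fun x hx y hy =>
    add_mem_sub_of_two_mul_card_lt hsmall hx hy
  have hneg : ∀ x ∈ Q, -x ∈ Q := by
    intro x hx
    obtain ⟨a, ha, b, hb, rfl⟩ := mem_sub.1 hx
    rw [neg_sub]
    exact sub_mem_sub hb ha
  have h0Q : (0 : ZMod l) ∈ Q := by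
    have := sub_mem_sub h0A h0A
    rwa [sub_zero] at this
  have hmul : ∀ x ∈ Q, ∀ j : ℕ, j * x ∈ Q := by
    intro x hx j
    induction j with
    | zero => simpa using h0Q
    | succ j ih =>
      rw [Nat.cast_succ, add_mul, one_mul]
      exact hadd _ ih _ hx
  by_cases h1Q : (1 : ZMod l) ∈ Q
  · right
    have hQu : Q = univ := by
      refine eq_univ_iff_forall.2 fun q => ?_
      have := hmul 1 h1Q q.val
      rwa [mul_one, ZMod.natCast_zmod_val] at this
    have hQl : #Q = l := by rw [hQu, card_univ, ZMod.card]
    have h1 := hB.card_le_min hmB hmle (fun b hb => (mem_Icc.1 (hBn hb)).2) (by omega)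
    exact fun b hb => h1.trans (hmle b hb)
  · left
    have h2Q : (2 : ZMod l) ∈ Q := by
      by_contra h2Q
      have hshift : ∀ c : ZMod l, #(A.image fun a => a + c) = #A := fun c =>
        card_image_of_injective _ (add_left_injective c)
      have hd : ∀ c d : ZMod l, d - c ∉ Q →
          Disjoint (A.image fun a => a + c) (A.image fun a => a + d) := by
        intro c d hcd
        refine disjoint_left.2 fun x hx hx' => hcd ?_
        obtain ⟨a, ha, rfl⟩ := mem_image.1 hx
        obtain ⟨b, hb, e⟩ := mem_image.1 hx'
        have : d - c = a - b := by rw [sub_eq_sub_iff_add_eq_add, add_comm d b, e]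
        rw [this]
        exact sub_mem_sub ha hb
      have d1 := hd 0 1 (by simpa using h1Q)
      have d2 := hd 0 2 (by simpa using h2Q)
      have d3 := hd 1 2 (by
        have : (2 : ZMod l) - 1 = 1 := by ring
        rwa [this])
      have hc := card_le_univ ((A.image fun a => a + 0) ∪ ((A.image fun a => a + 1) ∪
        (A.image fun a => a + 2)))
      rw [card_union_of_disjoint (disjoint_union_right.2 ⟨d1, d2⟩), card_union_of_disjoint d3,
        hshift, hshift, hshift, ZMod.card] at hc
      omega
    have hpar : ∀ b ∈ B, ∃ j, b = m + 2 * j := by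
      intro b hb
      have hmb := hmle b hb
      rcases Nat.even_or_odd' (b - m) with ⟨j, hj | hj⟩
      · exact ⟨j, by omega⟩
      · exfalso
        have hbQ : ((b - m : ℕ) : ZMod l) ∈ Q := by
          have := sub_mem_sub (mem_image_of_mem (fun b => ((b - m : ℕ) : ZMod l)) hb) h0A
          rwa [sub_zero] at this
        have := hadd _ hbQ _ (hneg _ (hmul 2 h2Q j))
        rw [hj] at this
        apply h1Q
        have e : ((2 * j + 1 : ℕ) : ZMod l) + -(j * 2) = 1 := by push_cast; ring
        rwa [e] at this
    rcases Nat.even_or_odd m with hme | hmo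
    · exfalso
      have := hB.card_le_of_even hBn fun b hb => by
        obtain ⟨j, rfl⟩ := hpar b hb
        exact hme.add (even_two_mul j)
      omega
    · intro b hb
      obtain ⟨j, rfl⟩ := hpar b hb
      exact hmo.add_even (even_two_mul j)

/-- Two numbers are adjacent if together with an element of `S` they form a Schur triple. -/
def linkGraph (S : Finset ℕ) : SimpleGraph ℕ :=
  SimpleGraph.fromRel fun x y => x + y ∈ S ∨ ∃ s ∈ S, s + x = y

lemma linkGraph_adj {S : Finset ℕ} {x y : ℕ} :
    (linkGraph S).Adj x y ↔ x ≠ y ∧ ∃ s ∈ S, x + y = s ∨ s + x = y ∨ s + y = x := by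
  rw [linkGraph, SimpleGraph.fromRel_adj, add_comm y x]
  refine and_congr_right fun _ => ⟨?_, ?_⟩
  · rintro ((h | ⟨s, hs, h⟩) | (h | ⟨s, hs, h⟩))
    · exact ⟨_, h, .inl rfl⟩
    · exact ⟨s, hs, .inr (.inl h)⟩
    · exact ⟨_, h, .inl rfl⟩
    · exact ⟨s, hs, .inr (.inr h)⟩
  · rintro ⟨s, hs, rfl | h | h⟩
    · exact .inl (.inl hs)
    · exact .inl (.inr ⟨s, hs, h⟩)
    · exact .inr (.inr ⟨s, hs, h⟩)

open Classical in
/-- The elements of `B` which form a sum-free set together with `S`. -/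
noncomputable def compatible (B S : Finset ℕ) : Finset ℕ := {b ∈ B | SumFree (insert b S)}

lemma mem_compatible {B S : Finset ℕ} {b : ℕ} :
    b ∈ compatible B S ↔ b ∈ B ∧ SumFree (insert b S) := by
  simp [compatible]

lemma compatible_subset {B S : Finset ℕ} : compatible B S ⊆ B := fun _ h => (mem_compatible.1 h).1

open Classical in
/-- The maximal sum-free subsets of `[n]`. -/
noncomputable def maxSumFreeFinset (n : ℕ) : Finset (Finset ℕ) :=
  (Icc 1 n).powerset.filter (IsMaxSumFree n)

lemma mem_maxSumFreeFinset {n : ℕ} {I : Finset ℕ} : I ∈ maxSumFreeFinset n ↔ IsMaxSumFree n I := by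
  simp only [maxSumFreeFinset, mem_filter, mem_powerset, and_iff_right_iff_imp]
  exact fun h => h.1

lemma fmax_eq_card (n : ℕ) : fmax n = #(maxSumFreeFinset n) := by
  rw [fmax, ← Set.ncard_coe_finset]
  congr 1
  ext I
  simp [mem_maxSumFreeFinset]

lemma IsMaxSumFree.isMaxIndepIn {n : ℕ} {I B : Finset ℕ} (hI : IsMaxSumFree n I)
    (hBn : B ⊆ Icc 1 n) (hB : SumFree B) :
    IsMaxIndepIn (linkGraph (I \ B)) (compatible B (I \ B)) (I ∩ B) := by
  obtain ⟨hIn, hIs, hmax⟩ := hI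
  have hS : ∀ s ∈ I \ B, s ∈ I := fun s hs => (mem_sdiff.1 hs).1
  refine ⟨?_, ?_, ?_⟩
  · intro x hx
    obtain ⟨h1, h2⟩ := mem_inter.1 hx
    exact mem_compatible.2 ⟨h2, hIs.mono (insert_subset h1 sdiff_subset)⟩
  · intro u hu v hv h
    have hu' := (mem_inter.1 hu).1
    have hv' := (mem_inter.1 hv).1
    obtain ⟨-, s, hs, rfl | rfl | rfl⟩ := linkGraph_adj.1 h
    · exact hIs _ hu' _ hv' (hS _ hs)
    · exact hIs _ (hS _ hs) _ hu' hv'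
    · exact hIs _ (hS _ hs) _ hv' hu'
  · intro v hv hvI
    obtain ⟨hvB, hvS⟩ := mem_compatible.1 hv
    have hvI' : v ∉ I := fun h => hvI (mem_inter.2 ⟨h, hvB⟩)
    have hns : ¬ SumFree (insert v I) := fun h => by
      have := hmax _ (insert_subset (hBn hvB) hIn) h (subset_insert _ _)
      exact hvI' (this ▸ mem_insert_self _ _)
    by_contra hno
    push Not at hno
    have hno' : ∀ u ∈ I, u ∈ B → ∀ s ∈ I \ B, v + u ≠ s ∧ s + v ≠ u ∧ s + u ≠ v := by
      intro u hu huB s hs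
      have hvu : v ≠ u := fun h => hvI' (h ▸ hu)
      have := hno u (mem_inter.2 ⟨hu, huB⟩)
      rw [linkGraph_adj] at this
      refine ⟨fun h => this ⟨hvu, s, hs, .inl h⟩, fun h => this ⟨hvu, s, hs, .inr (.inl h)⟩,
        fun h => this ⟨hvu, s, hs, .inr (.inr h)⟩⟩
    have hcl : ∀ x ∈ insert v I, (x = v ∧ x ∈ B ∧ x ∈ insert v (I \ B)) ∨
        (x ∈ I \ B ∧ x ∈ I ∧ x ∈ insert v (I \ B)) ∨ (x ∈ I ∧ x ∈ B) := by
      intro x hx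
      rcases mem_insert.1 hx with rfl | h
      · exact .inl ⟨rfl, hvB, mem_insert_self _ _⟩
      · by_cases hxB : x ∈ B
        · exact .inr (.inr ⟨h, hxB⟩)
        · have := mem_sdiff.2 ⟨h, hxB⟩
          exact .inr (.inl ⟨this, h, mem_insert_of_mem this⟩)
    refine hns fun x hx y hy hxy => ?_
    rcases hcl x hx with ⟨ex, hxB, hxS⟩ | ⟨ex, hxI, hxS⟩ | ⟨hxI, hxB⟩ <;>
      rcases hcl y hy with ⟨ey, hyB, hyS⟩ | ⟨ey, hyI, hyS⟩ | ⟨hyI, hyB⟩ <;>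
      rcases hcl _ hxy with ⟨ez, hzB, hzS⟩ | ⟨ez, hzI, hzS⟩ | ⟨hzI, hzB⟩
    all_goals first
      | exact hIs x hxI y hyI hzI
      | exact hB x hxB y hyB hzB
      | exact hvS x hxS y hyS hzS
      | exact (hno' y hyI hyB _ ez).1 (by omega)
      | exact (hno' x hxI hxB _ ez).1 (by omega)
      | exact (hno' _ hzI hzB _ ex).2.1 (by omega)
      | exact (hno' _ hzI hzB _ ey).2.1 (by omega)
      | exact (hno' x hxI hxB _ ey).2.2 (by omega)
      | exact (hno' y hyI hyB _ ex).2.2 (by omega)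

open Classical in
lemma card_filter_sdiff_eq_le {n : ℕ} {B : Finset ℕ} (hBn : B ⊆ Icc 1 n) (hB : SumFree B)
    (S : Finset ℕ) : #((maxSumFreeFinset n).filter fun I => I \ B = S) ≤
      #(maxIndepFinset (linkGraph S) (compatible B S)) := by
  refine card_le_card_of_injOn (fun I => I ∩ B) ?_ ?_
  · intro I hI
    obtain ⟨hI', rfl⟩ := mem_filter.1 (mem_coe.1 hI)
    exact mem_maxIndepFinset.2 ((mem_maxSumFreeFinset.1 hI').isMaxIndepIn hBn hB)
  · intro I hI J hJ hIJ
    have h1 := (mem_filter.1 hI).2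
    have h2 := (mem_filter.1 hJ).2
    have h3 : I ∩ B = J ∩ B := hIJ
    rw [← sdiff_union_inter I B, ← sdiff_union_inter J B, h1, h2, h3]

/-- A triangle of a link graph without sums would give a Schur triple of differences. -/
lemma SumFree.not_adj_of_lt {S : Finset ℕ} (hS : SumFree S) {n a b c : ℕ} (hSn : ∀ s ∈ S, s ≤ n)
    (ha : n < 2 * a) (hb : n < 2 * b) (hc : n < 2 * c) (hab : (linkGraph S).Adj a b)
    (hbc : (linkGraph S).Adj b c) : ¬ (linkGraph S).Adj a c := by
  intro hac
  obtain ⟨-, r, hr, h1⟩ := linkGraph_adj.1 hab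
  obtain ⟨-, s, hs, h2⟩ := linkGraph_adj.1 hbc
  obtain ⟨-, t, ht, h3⟩ := linkGraph_adj.1 hac
  have hr' := hSn r hr
  have hs' := hSn s hs
  have ht' := hSn t ht
  have e1 : r + s ≠ t := fun h => hS r hr s hs (h ▸ ht)
  have e2 : r + t ≠ s := fun h => hS r hr t ht (h ▸ hs)
  have e3 : s + t ≠ r := fun h => hS s hs t ht (h ▸ hr)
  omega

open Classical in
lemma card_filter_sdiff_eq_le_of_not_odd {n : ℕ} {B : Finset ℕ} (hBn : B ⊆ Icc 1 n)
    (hB : SumFree B) (hodd : ¬ ∀ b ∈ B, Odd b) (hn : 100 ≤ n) (S : Finset ℕ) :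
    (#((maxSumFreeFinset n).filter fun I => I \ B = S) : ℝ) ≤ 2 ^ ((n : ℝ) / 4 + 1) := by
  rcases eq_empty_or_nonempty ((maxSumFreeFinset n).filter fun I => I \ B = S) with he | ⟨I, hI⟩
  · rw [he]
    simp only [card_empty, Nat.cast_zero]
    positivity
  obtain ⟨hI, hIS⟩ := mem_filter.1 hI
  obtain ⟨hIn, hIs, -⟩ := mem_maxSumFreeFinset.1 hI
  have hSI : S ⊆ I := hIS ▸ sdiff_subset
  have hS : SumFree S := hIs.mono hSI
  have hSn : ∀ s ∈ S, s ≤ n := fun s hs => (mem_Icc.1 (hIn (hSI hs))).2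
  have hQ : #(compatible B S) ≤ #B := card_le_card compatible_subset
  refine (Nat.cast_le.2 (card_filter_sdiff_eq_le hBn hB S)).trans ?_
  by_cases hcard : 46 * n ≤ 100 * #B
  · have hmin := (hB.odd_or_card_le hBn hcard hn).resolve_left hodd
    set W := (compatible B S).filter fun b => 2 * b ≤ n with hW
    refine (card_maxIndep_le_of_triangles_meet (G := linkGraph S) (compatible B S) W
      (filter_subset _ _) ?_).trans (Real.rpow_le_rpow_of_exponent_le one_le_two ?_)
    · intro a ha b hb c hc
      have key : ∀ x ∈ compatible B S \ W, n < 2 * x := by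
        intro x hx
        by_contra h
        exact (mem_sdiff.1 hx).2 (mem_filter.2 ⟨(mem_sdiff.1 hx).1, not_lt.1 h⟩)
      exact hS.not_adj_of_lt hSn (key a ha) (key b hb) (key c hc)
    · have h1 : #W ≤ n / 2 + 1 - #B := by
        have : W ⊆ Icc #B (n / 2) := by
          intro x hx
          obtain ⟨h1, h2⟩ := mem_filter.1 hx
          have := hmin x (compatible_subset h1)
          exact mem_Icc.2 ⟨this, by omega⟩
        simpa using card_le_card this
      have h2 : #B ≤ n + 1 - #B := by
        have : B ⊆ Icc #B n := fun x hx => mem_Icc.2 ⟨hmin x hx, (mem_Icc.1 (hBn hx)).2⟩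
        simpa using card_le_card this
      have h3 : 2 * (#(compatible B S) + #W) ≤ n + 2 := by omega
      have h4 : (2 : ℝ) * (#(compatible B S) + #W) ≤ n + 2 := by exact_mod_cast h3
      linarith
  · refine (card_maxIndep_le _).trans (Real.rpow_le_rpow_of_exponent_le one_le_two ?_)
    have h3 : 100 * #(compatible B S) ≤ 46 * n := by omega
    have h4 : (100 : ℝ) * #(compatible B S) ≤ 46 * n := by exact_mod_cast h3
    linarith

/-- The odd elements of `[n]`. -/
def oddNumbers (n : ℕ) : Finset ℕ := (Icc 1 n).filter Odd

lemma mem_oddNumbers {n x : ℕ} : x ∈ oddNumbers n ↔ x ≤ n ∧ Odd x := by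
  simp only [oddNumbers, mem_filter, mem_Icc]
  refine ⟨fun h => ⟨h.1.2, h.2⟩, fun h => ⟨⟨h.2.pos, h.1⟩, h.2⟩⟩

lemma oddNumbers_subset {n : ℕ} : oddNumbers n ⊆ Icc 1 n := filter_subset _ _

lemma sumFree_oddNumbers (n : ℕ) : SumFree (oddNumbers n) := fun _ hx _ hy h =>
  Nat.not_even_iff_odd.2 (mem_oddNumbers.1 h).2
    ((mem_oddNumbers.1 hx).2.add_odd (mem_oddNumbers.1 hy).2)

lemma two_mul_card_oddNumbers_le (n : ℕ) : 2 * #(oddNumbers n) ≤ n + 1 := by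
  have : oddNumbers n ⊆ (range ((n + 1) / 2)).image fun i => 2 * i + 1 := by
    intro x hx
    obtain ⟨h1, k, rfl⟩ := mem_oddNumbers.1 hx
    exact mem_image.2 ⟨k, mem_range.2 (by omega), rfl⟩
  have := (card_le_card this).trans card_image_le
  rw [card_range] at this
  omega

open Classical in
lemma card_le_two_mul_degree {n v : ℕ} {S : Finset ℕ} (hSn : S ⊆ Icc 1 n) (hS : ∀ s ∈ S, Even s)
    (hv : v ∈ oddNumbers n) : #S ≤ 2 * #((oddNumbers n).filter ((linkGraph S).Adj v)) + 1 := by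
  obtain ⟨hvn, hvo⟩ := mem_oddNumbers.1 hv
  set N := (oddNumbers n).filter ((linkGraph S).Adj v) with hN
  have : S ⊆ insert (2 * v) (N.image (fun t => v + t) ∪ N.image fun t => v - t) := by
    intro s hs
    have hsn := mem_Icc.1 (hSn hs)
    have hse := hS s hs
    by_cases h2 : s = 2 * v
    · simp [h2]
    refine mem_insert_of_mem (mem_union.2 ?_)
    rcases le_total v s with h | h
    · refine .inl (mem_image.2 ⟨s - v, mem_filter.2 ⟨mem_oddNumbers.2 ⟨by omega, ?_⟩,
        linkGraph_adj.2 ⟨by omega, s, hs, .inl (by omega)⟩⟩, by omega⟩)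
      exact Nat.Even.sub_odd h hse hvo
    · refine .inr (mem_image.2 ⟨v - s, mem_filter.2 ⟨mem_oddNumbers.2 ⟨by omega, ?_⟩,
        linkGraph_adj.2 ⟨by omega, s, hs, .inr (.inr (by omega))⟩⟩, by omega⟩)
      exact Nat.Odd.sub_even h hvo hse
  have h1 := (card_le_card this).trans (card_insert_le _ _)
  have h2 := card_union_le (N.image (fun t => v + t)) (N.image fun t => v - t)
  have h3 : #(N.image fun t => v + t) ≤ #N := card_image_le
  have h4 : #(N.image fun t => v - t) ≤ #N := card_image_le
  omega

open Classical in
lemma card_filter_linkGraph_adj_le (S F : Finset ℕ) (v : ℕ) :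
    #(F.filter fun u => (linkGraph S).Adj u v) ≤ 2 * #S := by
  have : F.filter (fun u => (linkGraph S).Adj u v) ⊆
      S.image (fun s => s + v) ∪ S.image fun s => (s - v) + (v - s) := by
    intro u hu
    obtain ⟨-, s, hs, h⟩ := linkGraph_adj.1 (mem_filter.1 hu).2
    rw [mem_union, mem_image, mem_image]
    rcases h with h | h | h
    · exact .inr ⟨s, hs, by omega⟩
    · exact .inr ⟨s, hs, by omega⟩
    · exact .inl ⟨s, hs, h⟩
  have h1 := (card_le_card this).trans (card_union_le _ _)
  have h3 : #(S.image fun s => s + v) ≤ #S := card_image_le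
  have h4 : #(S.image fun s => (s - v) + (v - s)) ≤ #S := card_image_le
  omega

open Classical in
/-- A vertex set of the link graph with small maximum degree misses many odd numbers. -/
lemma card_le_of_degree_lt {n : ℕ} {S F : Finset ℕ} (hSn : S ⊆ Icc 1 n) (hS : ∀ s ∈ S, Even s)
    (hcard : 30 ≤ #S) (hF : F ⊆ oddNumbers n)
    (hdeg : ∀ v ∈ F, #(F.filter ((linkGraph S).Adj v)) < #S / 4 + 1) :
    13 * #F ≤ 12 * #(oddNumbers n) := by
  have h := card_mul_le_card_mul (s := F) (t := oddNumbers n \ F) (m := #S / 5) (n := 2 * #S)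
    (linkGraph S).Adj ?_ fun v _ => card_filter_linkGraph_adj_le S F v
  · have h1 := card_sdiff_add_card_eq_card hF
    have h2 : 0 < #S / 5 := by omega
    have h3 : #F * (#S / 5) ≤ 12 * #(oddNumbers n \ F) * (#S / 5) := by
      refine h.trans ?_
      have : 2 * #S ≤ 12 * (#S / 5) := by omega
      calc _ ≤ #(oddNumbers n \ F) * (12 * (#S / 5)) := Nat.mul_le_mul_left _ this
        _ = _ := by ring
    have := Nat.le_of_mul_le_mul_right h3 h2
    omega
  · intro v hv
    have h1 := card_le_two_mul_degree hSn hS (hF hv)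
    have h2 := hdeg v hv
    have h3 : (oddNumbers n).filter ((linkGraph S).Adj v) =
        F.filter ((linkGraph S).Adj v) ∪ (oddNumbers n \ F).filter ((linkGraph S).Adj v) := by
      rw [← filter_union, union_sdiff_of_subset hF]
    have h4 := card_union_le (F.filter ((linkGraph S).Adj v))
      ((oddNumbers n \ F).filter ((linkGraph S).Adj v))
    rw [← h3] at h4
    have h5 : #((oddNumbers n \ F).bipartiteAbove (linkGraph S).Adj v) =
        #((oddNumbers n \ F).filter ((linkGraph S).Adj v)) := rfl
    omega

open Classical in
/-- Numbers which are half a signed sum of three elements of `S`. -/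
lemma exists_triangle_cover {S Q : Finset ℕ} (hS : SumFree S) : ∃ W ⊆ Q, #W ≤ 3 * #S ^ 3 ∧
    ∀ a ∈ Q \ W, ∀ b ∈ Q \ W, ∀ c ∈ Q \ W, (linkGraph S).Adj a b → (linkGraph S).Adj b c →
      ¬ (linkGraph S).Adj a c := by
  set P := S ×ˢ S ×ˢ S with hP
  set f : ℕ × ℕ × ℕ → ℕ := fun p => (p.1 + p.2.1 + p.2.2) / 2 with hf
  set g : ℕ × ℕ × ℕ → ℕ := fun p => (p.1 + p.2.1 - p.2.2) / 2 with hg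
  set h : ℕ × ℕ × ℕ → ℕ := fun p => (p.1 - p.2.1 - p.2.2) / 2 with hh
  refine ⟨Q ∩ (P.image f ∪ (P.image g ∪ P.image h)), inter_subset_left, ?_, ?_⟩
  · have hPc : #P = #S ^ 3 := by
      rw [hP, card_product, card_product]; ring
    have h1 : #(P.image f) ≤ #P := card_image_le
    have h2 : #(P.image g) ≤ #P := card_image_le
    have h3 : #(P.image h) ≤ #P := card_image_le
    have h4 := card_union_le (P.image f) (P.image g ∪ P.image h)
    have h5 := card_union_le (P.image g) (P.image h)
    have h6 := card_le_card (inter_subset_right : Q ∩ (P.image f ∪ (P.image g ∪ P.image h)) ⊆ _)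
    omega
  · have key : ∀ x ∈ Q \ (Q ∩ (P.image f ∪ (P.image g ∪ P.image h))), ∀ r ∈ S, ∀ s ∈ S, ∀ t ∈ S,
        2 * x ≠ r + s + t ∧ 2 * x + t ≠ r + s ∧ 2 * x + s + t ≠ r := by
      intro x hx r hr s hs t ht
      obtain ⟨hx1, hx2⟩ := mem_sdiff.1 hx
      have hm : (r, s, t) ∈ P := mem_product.2 ⟨hr, mem_product.2 ⟨hs, ht⟩⟩
      refine ⟨fun e => hx2 ?_, fun e => hx2 ?_, fun e => hx2 ?_⟩ <;>
        refine mem_inter.2 ⟨hx1, ?_⟩ <;> rw [mem_union, mem_union]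
      · refine .inl (mem_image.2 ⟨_, hm, ?_⟩)
        simp only [hf]; omega
      · refine .inr (.inl (mem_image.2 ⟨_, hm, ?_⟩))
        simp only [hg]; omega
      · refine .inr (.inr (mem_image.2 ⟨_, hm, ?_⟩))
        simp only [hh]; omega
    intro a ha b hb c hc hab hbc hac
    obtain ⟨-, r, hr, h1⟩ := linkGraph_adj.1 hab
    obtain ⟨-, s, hs, h2⟩ := linkGraph_adj.1 hbc
    obtain ⟨-, t, ht, h3⟩ := linkGraph_adj.1 hac
    have e1 : r + s ≠ t := fun h => hS r hr s hs (h ▸ ht)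
    have e2 : r + t ≠ s := fun h => hS r hr t ht (h ▸ hs)
    have e3 : s + t ≠ r := fun h => hS s hs t ht (h ▸ hr)
    have ka := key a ha
    have kb := key b hb
    have kc := key c hc
    have ka1 := ka r hr s hs t ht
    have ka2 := ka s hs t ht r hr
    have ka3 := ka t ht r hr s hs
    have kb1 := kb r hr s hs t ht
    have kb2 := kb s hs t ht r hr
    have kb3 := kb t ht r hr s hs
    have kc1 := kc r hr s hs t ht
    have kc2 := kc s hs t ht r hr
    have kc3 := kc t ht r hr s hs
    clear_value P f g h
    rcases h1 with h1 | h1 | h1 <;> rcases h2 with h2 | h2 | h2 <;> rcases h3 with h3 | h3 | h3 <;>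
      omega

open Classical in
lemma card_filter_sdiff_odd_le_of_card_le {n K : ℕ} {S : Finset ℕ} (hS : SumFree S)
    (hK : #S ≤ K) : (#((maxSumFreeFinset n).filter fun I => I \ oddNumbers n = S) : ℝ) ≤
      2 ^ ((n : ℝ) / 4 + (1 + 6 * K ^ 3) / 4) := by
  refine (Nat.cast_le.2 (card_filter_sdiff_eq_le oddNumbers_subset (sumFree_oddNumbers n)
    S)).trans ?_
  obtain ⟨W, hW, hWc, htri⟩ := exists_triangle_cover (Q := compatible (oddNumbers n) S) hS
  refine (card_maxIndep_le_of_triangles_meet (G := linkGraph S) _ W hW htri).trans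
    (Real.rpow_le_rpow_of_exponent_le one_le_two ?_)
  have h1 : #(compatible (oddNumbers n) S) ≤ #(oddNumbers n) := card_le_card compatible_subset
  have h2 := two_mul_card_oddNumbers_le n
  have h3 : #S ^ 3 ≤ K ^ 3 := Nat.pow_le_pow_left hK 3
  have h4 : 2 * (#(compatible (oddNumbers n) S) + #W) ≤ n + 1 + 6 * K ^ 3 := by omega
  have h5 : (2 : ℝ) * (#(compatible (oddNumbers n) S) + #W) ≤ n + 1 + 6 * K ^ 3 := by
    exact_mod_cast h4
  linarith

open Classical in
lemma card_filter_sdiff_odd_le_of_le_card {n : ℕ} {γ η : ℝ} {S : Finset ℕ} (hSn : S ⊆ Icc 1 n)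
    (hS : ∀ s ∈ S, Even s) (hn : 64 ≤ n) (hS30 : 30 ≤ #S) (hSγ : 4 ≤ γ * #S)
    (hγ : (#(smallSubsets (oddNumbers n) (γ * n)) : ℝ) ≤ 2 ^ (η * n)) :
    (#((maxSumFreeFinset n).filter fun I => I \ oddNumbers n = S) : ℝ) ≤
      2 ^ ((1 / 4 + η) * n) := by
  refine (Nat.cast_le.2 (card_filter_sdiff_eq_le oddNumbers_subset (sumFree_oddNumbers n)
    S)).trans ?_
  set O := oddNumbers n with hO
  set Q := compatible O S with hQ
  set G := linkGraph S with hG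
  obtain ⟨C, hC, hfp⟩ := exists_fingerprint G (#S / 4) O
  have hO2 := two_mul_card_oddNumbers_le n
  rw [← hO] at hO2
  have hsub : maxIndepFinset G Q ⊆ (smallSubsets O (γ * n)).biUnion fun T =>
      (maxIndepFinset G (C T ∩ Q)).image fun J => T ∪ J := by
    intro J hJ
    have hJ' := mem_maxIndepFinset.1 hJ
    obtain ⟨T, hTJ, hTc, hJT, hadj⟩ := hfp J (hJ'.1.trans compatible_subset) hJ'.2.1
    have hJT' : J ⊆ T ∪ C T ∩ Q := by
      intro x hx
      rcases mem_union.1 (hJT hx) with h | h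
      · exact mem_union_left _ h
      · exact mem_union_right _ (mem_inter.2 ⟨h, hJ'.1 hx⟩)
    refine mem_biUnion.2 ⟨T, mem_smallSubsets.2 ⟨hTJ.trans (hJ'.1.trans compatible_subset), ?_⟩,
      mem_image.2 ⟨J ∩ (C T ∩ Q), mem_maxIndepFinset.2 ?_, ?_⟩⟩
    · have h1 : #S * #T ≤ 4 * n := by
        have : #S * #T ≤ 4 * ((#S / 4 + 1) * #T) := by
          rw [← mul_assoc]
          exact Nat.mul_le_mul_right _ (by omega)
        omega
      have h2 : (#S : ℝ) * #T ≤ 4 * n := by exact_mod_cast h1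
      have hS0 : (0 : ℝ) < #S := by
        have : 0 < #S := by omega
        exact_mod_cast this
      have hn0 : (0 : ℝ) ≤ n := Nat.cast_nonneg n
      refine le_of_mul_le_mul_left ?_ hS0
      nlinarith
    · exact hJ'.restrict inter_subset_right hJT' fun x hx v hv =>
        hadj x hx v (mem_inter.1 hv).1
    · refine Subset.antisymm (union_subset hTJ inter_subset_left) fun x hx => ?_
      rcases mem_union.1 (hJT' hx) with h | h
      · exact mem_union_left _ h
      · exact mem_union_right _ (mem_inter.2 ⟨hx, h⟩)
  have hterm : ∀ T ∈ smallSubsets O (γ * n),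
      (#((maxIndepFinset G (C T ∩ Q)).image fun J => T ∪ J) : ℝ) ≤ 2 ^ ((1 / 4 : ℝ) * n) := by
    intro T _
    refine (Nat.cast_le.2 card_image_le).trans ((card_maxIndep_le _).trans
      (Real.rpow_le_rpow_of_exponent_le one_le_two ?_))
    have h1 := card_le_of_degree_lt hSn hS hS30 (hC T).1 (hC T).2
    rw [← hO] at h1
    have h2 : #(C T ∩ Q) ≤ #(C T) := card_le_card inter_subset_left
    have h3 : 26 * #(C T ∩ Q) ≤ 12 * (n + 1) := by omega
    have h4 : (26 : ℝ) * #(C T ∩ Q) ≤ 12 * (n + 1) := by exact_mod_cast h3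
    have h5 : (64 : ℝ) ≤ n := by exact_mod_cast hn
    linarith
  calc (#(maxIndepFinset G Q) : ℝ)
      ≤ ∑ T ∈ smallSubsets O (γ * n),
          (#((maxIndepFinset G (C T ∩ Q)).image fun J => T ∪ J) : ℝ) := by
        exact_mod_cast (card_le_card hsub).trans card_biUnion_le
    _ ≤ #(smallSubsets O (γ * n)) • (2 : ℝ) ^ ((1 / 4 : ℝ) * n) := sum_le_card_nsmul _ _ _ hterm
    _ ≤ 2 ^ (η * n) * (2 : ℝ) ^ ((1 / 4 : ℝ) * n) := by
        rw [nsmul_eq_mul]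
        exact mul_le_mul_of_nonneg_right hγ (by positivity)
    _ = 2 ^ ((1 / 4 + η) * n) := by
        rw [← Real.rpow_add two_pos]
        congr 1
        ring

open Classical in
theorem exists_card_filter_sdiff_odd_le {η : ℝ} (hη : 0 < η) : ∃ N, ∀ n ≥ N, ∀ S,
    (#((maxSumFreeFinset n).filter fun I => I \ oddNumbers n = S) : ℝ) ≤
      2 ^ ((1 / 4 + η) * n) := by
  obtain ⟨γ, hγ, hsmall⟩ := exists_card_smallSubsets_le hη
  obtain ⟨K, hK⟩ := exists_nat_ge (max 30 (4 / γ))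
  have hK30 : 30 ≤ K := by exact_mod_cast (le_max_left _ _).trans hK
  have hKγ : 4 ≤ γ * K := by
    have := (div_le_iff₀ hγ).1 ((le_max_right _ _).trans hK)
    linarith
  obtain ⟨N, hN⟩ := exists_nat_ge ((1 + 6 * (K : ℝ) ^ 3) / 4 / η)
  refine ⟨max N 64, fun n hn S => ?_⟩
  rcases eq_empty_or_nonempty ((maxSumFreeFinset n).filter fun I => I \ oddNumbers n = S) with
    he | ⟨I, hI⟩
  · rw [he]
    simp only [card_empty, Nat.cast_zero]
    positivity
  obtain ⟨hI, hIS⟩ := mem_filter.1 hI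
  obtain ⟨hIn, hIs, -⟩ := mem_maxSumFreeFinset.1 hI
  have hSI : S ⊆ I := hIS ▸ sdiff_subset
  rcases le_total #S K with h | h
  · refine (card_filter_sdiff_odd_le_of_card_le (hIs.mono hSI) h).trans
      (Real.rpow_le_rpow_of_exponent_le one_le_two ?_)
    have h1 : (N : ℝ) ≤ n := by exact_mod_cast (le_max_left _ _).trans hn
    have := (div_le_iff₀ hη).1 (hN.trans h1)
    linarith
  · refine card_filter_sdiff_odd_le_of_le_card (hSI.trans hIn) (fun s hs => ?_)
      ((le_max_right _ _).trans hn) (hK30.trans h) (hKγ.trans ?_) (hsmall n _ ?_)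
    · rw [← hIS] at hs
      by_contra ho
      exact (mem_sdiff.1 hs).2 (mem_oddNumbers.2
        ⟨(mem_Icc.1 (hIn (mem_sdiff.1 hs).1)).2, Nat.not_even_iff_odd.1 ho⟩)
    · exact mul_le_mul_of_nonneg_left (by exact_mod_cast h) hγ.le
    · have := two_mul_card_oddNumbers_le n
      have : 64 ≤ n := (le_max_right _ _).trans hn
      omega

open Classical in
theorem exists_fmax_le {ε : ℝ} (hε : 0 < ε) :
    ∃ N, ∀ n ≥ N, (fmax n : ℝ) ≤ 2 ^ ((1 / 4 + ε) * n) := by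
  obtain ⟨η, hη, hηε⟩ : ∃ η, 0 < η ∧ 4 * η = ε := ⟨ε / 4, by positivity, by ring⟩
  obtain ⟨γ, hγ, hsmall⟩ := exists_card_smallSubsets_le hη
  obtain ⟨N₁, hN₁⟩ := exists_sumFree_container_family (lt_min hη hγ)
  obtain ⟨N₂, hN₂⟩ := exists_card_filter_sdiff_odd_le hη
  obtain ⟨N₃, hN₃⟩ := exists_nat_ge (1 / η)
  refine ⟨max (max N₁ N₂) (max N₃ 100), fun n hn => ?_⟩
  simp only [ge_iff_le, max_le_iff] at hn
  obtain ⟨⟨hn₁, hn₂⟩, hn₃, hn₄⟩ := hn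
  have hn₃' : (N₃ : ℝ) ≤ n := by exact_mod_cast hn₃
  have hηn : 1 ≤ n * η := (div_le_iff₀ hη).1 (hN₃.trans hn₃')
  have hn0 : (0 : ℝ) ≤ n := Nat.cast_nonneg n
  obtain ⟨𝓑, h𝓑c, h𝓑, hcont⟩ := hN₁ n hn₁
  set 𝓓 := insert (oddNumbers n) (𝓑.filter fun B => ¬ ∀ b ∈ B, Odd b) with h𝓓
  set P := smallSubsets (Icc 1 n) (γ * n) with hP
  have hPc : (#P : ℝ) ≤ 2 ^ (η * n) := hsmall n _ (by simp)
  have h𝓓c : (#𝓓 : ℝ) ≤ 2 ^ (2 * (η * n)) := by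
    have h1 : (#𝓓 : ℝ) ≤ #𝓑 + 1 := by
      exact_mod_cast (card_insert_le _ _).trans (Nat.add_le_add_right (card_filter_le _ _) 1)
    have h2 : (#𝓑 : ℝ) ≤ 2 ^ (η * n) := h𝓑c.trans
      (Real.rpow_le_rpow_of_exponent_le one_le_two
        (mul_le_mul_of_nonneg_right (min_le_left _ _) hn0))
    have h3 : (2 : ℝ) ≤ 2 ^ (η * n) := by
      calc (2 : ℝ) = 2 ^ (1 : ℝ) := (Real.rpow_one 2).symm
        _ ≤ _ := Real.rpow_le_rpow_of_exponent_le one_le_two (by linarith)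
    have h4 : (2 : ℝ) ^ (2 * (η * n)) = 2 ^ (η * n) * 2 ^ (η * n) := by
      rw [← Real.rpow_add two_pos]
      congr 1
      ring
    rw [h4]
    nlinarith
  have hclass : ∀ B ∈ 𝓓, ∀ S, (#((maxSumFreeFinset n).filter fun I => I \ B = S) : ℝ) ≤
      2 ^ ((1 / 4 + η) * n) := by
    intro B hB S
    rcases mem_insert.1 hB with rfl | hB
    · exact hN₂ n hn₂ S
    · obtain ⟨hB, hodd⟩ := mem_filter.1 hB
      refine (card_filter_sdiff_eq_le_of_not_odd (h𝓑 B hB).1 (h𝓑 B hB).2 hodd hn₄ S).trans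
        (Real.rpow_le_rpow_of_exponent_le one_le_two ?_)
      linarith
  have hsub : maxSumFreeFinset n ⊆ 𝓓.biUnion fun B => P.biUnion fun S =>
      (maxSumFreeFinset n).filter fun I => I \ B = S := by
    intro I hI
    obtain ⟨hIn, hIs, -⟩ := mem_maxSumFreeFinset.1 hI
    obtain ⟨B, hB, hIB⟩ := hcont I hIn hIs
    have key : ∃ D ∈ 𝓓, #(I \ D) ≤ #(I \ B) := by
      by_cases hodd : ∀ b ∈ B, Odd b
      · refine ⟨oddNumbers n, mem_insert_self _ _, card_le_card (sdiff_subset_sdiff Subset.rfl ?_)⟩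
        exact fun b hb => mem_filter.2 ⟨(h𝓑 B hB).1 hb, hodd b hb⟩
      · exact ⟨B, mem_insert_of_mem (mem_filter.2 ⟨hB, hodd⟩), le_rfl⟩
    obtain ⟨D, hD, hDB⟩ := key
    refine mem_biUnion.2 ⟨D, hD, mem_biUnion.2 ⟨I \ D, mem_smallSubsets.2
      ⟨sdiff_subset.trans hIn, ?_⟩, mem_filter.2 ⟨hI, rfl⟩⟩⟩
    have : (#(I \ D) : ℝ) ≤ #(I \ B) := by exact_mod_cast hDB
    exact this.trans (hIB.trans (mul_le_mul_of_nonneg_right (min_le_right _ _) hn0))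
  have hinner : ∀ B ∈ 𝓓, (#(P.biUnion fun S =>
      (maxSumFreeFinset n).filter fun I => I \ B = S) : ℝ) ≤
      2 ^ (η * n) * 2 ^ ((1 / 4 + η) * n) := by
    intro B hB
    calc (#(P.biUnion fun S => (maxSumFreeFinset n).filter fun I => I \ B = S) : ℝ)
        ≤ ∑ S ∈ P, (#((maxSumFreeFinset n).filter fun I => I \ B = S) : ℝ) := by
          exact_mod_cast card_biUnion_le
      _ ≤ #P • (2 : ℝ) ^ ((1 / 4 + η) * n) := sum_le_card_nsmul _ _ _ fun S _ => hclass B hB S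
      _ ≤ _ := by
          rw [nsmul_eq_mul]
          exact mul_le_mul_of_nonneg_right hPc (by positivity)
  calc (fmax n : ℝ) = #(maxSumFreeFinset n) := by rw [fmax_eq_card]
    _ ≤ ∑ B ∈ 𝓓, (#(P.biUnion fun S =>
          (maxSumFreeFinset n).filter fun I => I \ B = S) : ℝ) := by
        exact_mod_cast (card_le_card hsub).trans card_biUnion_le
    _ ≤ #𝓓 • (2 ^ (η * n) * (2 : ℝ) ^ ((1 / 4 + η) * n)) := sum_le_card_nsmul _ _ _ hinner
    _ ≤ 2 ^ (2 * (η * n)) * (2 ^ (η * n) * (2 : ℝ) ^ ((1 / 4 + η) * n)) := by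
        rw [nsmul_eq_mul]
        exact mul_le_mul_of_nonneg_right h𝓓c (by positivity)
    _ = 2 ^ ((1 / 4 + ε) * n) := by
        rw [← Real.rpow_add two_pos, ← Real.rpow_add two_pos, ← hηε]
        congr 1
        ring

open Classical in
lemma SumFree.exists_isMaxSumFree {n : ℕ} {A : Finset ℕ} (hA : SumFree A) (hAn : A ⊆ Icc 1 n) :
    ∃ I, A ⊆ I ∧ IsMaxSumFree n I := by
  set F := (Icc 1 n).powerset.filter fun T => SumFree T ∧ A ⊆ T with hF
  have hmem : ∀ {T}, T ∈ F ↔ T ⊆ Icc 1 n ∧ SumFree T ∧ A ⊆ T := by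
    intro T
    rw [hF, mem_filter, mem_powerset]
  obtain ⟨I, hI, hmax⟩ := exists_max_image F card ⟨A, hmem.2 ⟨hAn, hA, Subset.rfl⟩⟩
  obtain ⟨hIn, hIs, hAI⟩ := hmem.1 hI
  exact ⟨I, hAI, hIn, hIs, fun T hT hTs hIT =>
    eq_of_subset_of_card_le hIT (hmax T (hmem.2 ⟨hT, hTs, hAI.trans hIT⟩))⟩

/-- One element out of each pair `{2 i + 1, m - (2 i + 1)}` with `i < k`, together with `m`. -/
def pairChoice (m k : ℕ) (P : Finset ℕ) : Finset ℕ :=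
  insert m ((range k).image fun i => if i ∈ P then 2 * i + 1 else m - (2 * i + 1))

lemma odd_of_mem_pairChoice {m k x : ℕ} {P : Finset ℕ} (hm : Even m) (hk : 4 * k ≤ m)
    (hx : x ∈ pairChoice m k P) : x = m ∨ (Odd x ∧ x < m ∧ m - x ∉ pairChoice m k P) := by
  obtain ⟨c, hc⟩ := hm
  rcases mem_insert.1 hx with rfl | h
  · exact .inl rfl
  obtain ⟨i, hi, rfl⟩ := mem_image.1 h
  rw [mem_range] at hi
  refine .inr ⟨?_, ?_, fun hmem => ?_⟩
  · split_ifs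
    · exact ⟨i, rfl⟩
    · exact ⟨c - i - 1, by omega⟩
  · split_ifs <;> omega
  · rcases mem_insert.1 hmem with h | h
    · split_ifs at h <;> omega
    · obtain ⟨j, hj, e⟩ := mem_image.1 h
      rw [mem_range] at hj
      by_cases h1 : i ∈ P <;> by_cases h2 : j ∈ P
      · rw [if_pos h1, if_pos h2] at e; omega
      · rw [if_pos h1, if_neg h2] at e
        exact h2 ((by omega : i = j) ▸ h1)
      · rw [if_neg h1, if_pos h2] at e
        exact h1 ((by omega : j = i) ▸ h2)
      · rw [if_neg h1, if_neg h2] at e; omega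

lemma sumFree_pairChoice {m k : ℕ} {P : Finset ℕ} (hm : Even m) (hk : 4 * k ≤ m) (hm0 : 0 < m) :
    SumFree (pairChoice m k P) := by
  intro x hx y hy hxy
  have ho : ∀ z, Odd z → 0 < z := fun z hz => hz.pos
  rcases odd_of_mem_pairChoice hm hk hx with rfl | ⟨hxo, hxm, hx'⟩
  · rcases odd_of_mem_pairChoice hm hk hxy with h | ⟨-, h, -⟩
    · rcases odd_of_mem_pairChoice hm hk hy with rfl | ⟨hyo, -, -⟩
      · omega
      · have := ho y hyo
        omega
    · omega
  · rcases odd_of_mem_pairChoice hm hk hy with rfl | ⟨hyo, hym, hy'⟩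
    · rcases odd_of_mem_pairChoice hm hk hxy with h | ⟨-, h, -⟩
      · have := ho x hxo
        omega
      · omega
    · rcases odd_of_mem_pairChoice hm hk hxy with h | ⟨h, -, -⟩
      · exact hx' ((by omega : y = m - x) ▸ hy)
      · exact Nat.not_even_iff_odd.2 h (hxo.add_odd hyo)

lemma pairChoice_subset {m k : ℕ} {P : Finset ℕ} (hk : 4 * k ≤ m) (hm0 : 0 < m) :
    pairChoice m k P ⊆ Icc 1 m := by
  intro x hx
  rw [mem_Icc]
  rcases mem_insert.1 hx with rfl | h
  · omega
  · obtain ⟨i, hi, rfl⟩ := mem_image.1 h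
    rw [mem_range] at hi
    split_ifs <;> omega

open Classical in
theorem two_pow_le_fmax {n m k : ℕ} (hm : Even m) (hk : 4 * k ≤ m) (hm0 : 0 < m) (hmn : m ≤ n) :
    2 ^ k ≤ fmax n := by
  have hex : ∀ P, ∃ I, pairChoice m k P ⊆ I ∧ IsMaxSumFree n I := fun P =>
    (sumFree_pairChoice hm hk hm0).exists_isMaxSumFree
      ((pairChoice_subset hk hm0).trans (Icc_subset_Icc_right hmn))
  choose E hE hEmax using hex
  have hmemE : ∀ P i, i < k → (i ∈ P ↔ 2 * i + 1 ∈ E P) := by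
    intro P i hi
    have hmE : m ∈ E P := hE P (mem_insert_self _ _)
    have h1 : (if i ∈ P then 2 * i + 1 else m - (2 * i + 1)) ∈ E P :=
      hE P (mem_insert_of_mem (mem_image_of_mem _ (mem_range.2 hi)))
    refine ⟨fun h => by rwa [if_pos h] at h1, fun h => ?_⟩
    by_contra hiP
    rw [if_neg hiP] at h1
    refine (hEmax P).2.1 _ h _ h1 ?_
    rwa [Nat.add_sub_cancel' (by omega)]
  rw [fmax_eq_card]
  calc 2 ^ k = #(range k).powerset := by rw [card_powerset, card_range]
    _ ≤ _ := by
      refine card_le_card_of_injOn E (fun P _ => mem_maxSumFreeFinset.2 (hEmax P)) ?_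
      intro P hP P' hP' hPP
      have hPs := mem_powerset.1 (mem_coe.1 hP)
      have hPs' := mem_powerset.1 (mem_coe.1 hP')
      ext i
      refine ⟨fun h => ?_, fun h => ?_⟩
      · have hi := mem_range.1 (hPs h)
        rw [hmemE P' i hi, ← hPP, ← hmemE P i hi]
        exact h
      · have hi := mem_range.1 (hPs' h)
        rw [hmemE P i hi, hPP, ← hmemE P' i hi]
        exact h

theorem exists_le_fmax {ε : ℝ} (hε : 0 < ε) :
    ∃ N : ℕ, ∀ n : ℕ, N ≤ n → (2 : ℝ) ^ ((1 / 4 - ε) * n) ≤ (fmax n : ℝ) := by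
  obtain ⟨N, hN⟩ := exists_nat_ge (1 / ε)
  refine ⟨max N 4, fun n hn => ?_⟩
  have hn4 : 4 ≤ n := (le_max_right _ _).trans hn
  have hnN : (N : ℝ) ≤ n := by exact_mod_cast (le_max_left _ _).trans hn
  have hεn : 1 ≤ n * ε := (div_le_iff₀ hε).1 (hN.trans hnN)
  have h1 : n < 4 * (n / 4) + 4 := by omega
  have h2 := two_pow_le_fmax (n := n) (m := 4 * (n / 4)) (k := n / 4)
    ⟨2 * (n / 4), by ring⟩ le_rfl (by omega) (by omega)
  have h3 : (n : ℝ) < 4 * (n / 4 : ℕ) + 4 := by exact_mod_cast h1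
  calc (2 : ℝ) ^ ((1 / 4 - ε) * n) ≤ 2 ^ ((n / 4 : ℕ) : ℝ) :=
        Real.rpow_le_rpow_of_exponent_le one_le_two (by linarith)
    _ = ((2 ^ (n / 4) : ℕ) : ℝ) := by rw [Real.rpow_natCast]; push_cast; rfl
    _ ≤ fmax n := by exact_mod_cast h2

theorem stmt0 :
    ∀ ε : ℝ, 0 < ε → ∃ N : ℕ, ∀ n : ℕ, N ≤ n →
      (2 : ℝ) ^ ((1 / 4 - ε) * n) ≤ (fmax n : ℝ) ∧
      (fmax n : ℝ) ≤ (2 : ℝ) ^ ((1 / 4 + ε) * n) := by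
  intro ε hε
  obtain ⟨N₁, h₁⟩ := exists_le_fmax hε
  obtain ⟨N₂, h₂⟩ := exists_fmax_le hε
  exact ⟨max N₁ N₂, fun n hn =>
    ⟨h₁ n ((le_max_left _ _).trans hn), h₂ n ((le_max_right _ _).trans hn)⟩⟩
end

section
/- For every positive integer n divisible by 4, the number of maximal sum-free subsets of [n] satisfies f_max(n) ≥ 2^{n/4}. -/
/-- Every sum-free subset of `[n]` extends to a maximal one. -/
theorem SumFree.exists_isMaxSumFree_superset {n : ℕ} {S : Finset ℕ} (hS : SumFree S)
    (hSn : S ⊆ Finset.Icc 1 n) : ∃ M, S ⊆ M ∧ IsMaxSumFree n M := by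
  have hfin : {T : Finset ℕ | T ⊆ Finset.Icc 1 n ∧ SumFree T}.Finite :=
    (Finset.finite_toSet (Finset.Icc 1 n).powerset).subset fun T hT => Finset.mem_powerset.2 hT.1
  obtain ⟨M, hSM, hM⟩ := hfin.exists_le_maximal (a := S) ⟨hSn, hS⟩
  exact ⟨M, hSM, hM.prop.1, hM.prop.2, fun T hT hTs hMT => hM.eq_of_le ⟨hT, hTs⟩ hMT⟩

/-- The set consisting of `4 * k` and one element of each pair `{2 * i + 1, 4 * k - (2 * i + 1)}`
with `i < k`, the smaller one being chosen exactly when `i ∈ A`. -/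
def oddPairChoice (k : ℕ) (A : Finset ℕ) : Finset ℕ :=
  insert (4 * k)
    ((Finset.range k).image fun i => if i ∈ A then 2 * i + 1 else 4 * k - (2 * i + 1))

theorem mem_oddPairChoice {k : ℕ} {A : Finset ℕ} {x : ℕ} :
    x ∈ oddPairChoice k A ↔ x = 4 * k ∨
      ∃ i < k, (i ∈ A ∧ x = 2 * i + 1) ∨ (i ∉ A ∧ x = 4 * k - (2 * i + 1)) := by
  simp only [oddPairChoice, Finset.mem_insert, Finset.mem_image, Finset.mem_range]
  refine or_congr_right (exists_congr fun i => and_congr_right fun _ => ?_)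
  split_ifs with h <;> simp [h, eq_comm]

theorem oddPairChoice_subset {k : ℕ} (hk : 0 < k) (A : Finset ℕ) :
    oddPairChoice k A ⊆ Finset.Icc 1 (4 * k) := by
  intro x hx
  rw [Finset.mem_Icc]
  rcases mem_oddPairChoice.1 hx with h | ⟨i, hi, ⟨-, h⟩ | ⟨-, h⟩⟩ <;> omega

theorem sumFree_oddPairChoice {k : ℕ} (hk : 0 < k) (A : Finset ℕ) :
    SumFree (oddPairChoice k A) := by
  intro x hx y hy hxy
  have hx1 := Finset.mem_Icc.1 (oddPairChoice_subset hk A hx)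
  have hy1 := Finset.mem_Icc.1 (oddPairChoice_subset hk A hy)
  have hxy1 := Finset.mem_Icc.1 (oddPairChoice_subset hk A hxy)
  rw [mem_oddPairChoice] at hx hy hxy
  obtain hx | ⟨i, hi, hx⟩ := hx
  · omega
  obtain hy | ⟨j, hj, hy⟩ := hy
  · omega
  have hsum : x + y = 4 * k := by
    obtain h | ⟨l, hl, h⟩ := hxy <;> omega
  have hij : i = j := by omega
  subst hij
  obtain ⟨hA, hx⟩ | ⟨hA, hx⟩ := hx <;> obtain ⟨hB, hy⟩ | ⟨hB, hy⟩ := hy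
  · omega
  · exact hB hA
  · exact hA hB
  · omega

/-- If two choices lie in a common sum-free set, then the index set of one contains the other. -/
theorem subset_of_oddPairChoice_subset {k : ℕ} {A B M : Finset ℕ} (hM : SumFree M)
    (hA : A ⊆ Finset.range k) (hAM : oddPairChoice k A ⊆ M) (hBM : oddPairChoice k B ⊆ M) :
    A ⊆ B := by
  intro i hi
  by_contra hiB
  have hik : i < k := Finset.mem_range.1 (hA hi)
  refine hM _ (hAM (mem_oddPairChoice.2 (.inr ⟨i, hik, .inl ⟨hi, rfl⟩⟩))) _
    (hBM (mem_oddPairChoice.2 (.inr ⟨i, hik, .inr ⟨hiB, rfl⟩⟩))) ?_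
  exact hAM (mem_oddPairChoice.2 (.inl (by omega)))

theorem stmt2 (n : ℕ) (hn : 0 < n) (h4 : 4 ∣ n) : 2 ^ (n / 4) ≤ fmax n := by
  obtain ⟨k, rfl⟩ := h4
  have hk : 0 < k := by omega
  choose M hsub hmax using fun A : Finset ℕ =>
    (sumFree_oddPairChoice hk A).exists_isMaxSumFree_superset (oddPairChoice_subset hk A)
  have hfin : {S : Finset ℕ | IsMaxSumFree (4 * k) S}.Finite :=
    (Finset.finite_toSet (Finset.Icc 1 (4 * k)).powerset).subset fun _ hT =>
      Finset.mem_powerset.2 hT.1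
  have hinj : Set.InjOn M ((Finset.range k).powerset : Set (Finset ℕ)) := by
    intro A hA B hB hAB
    rw [Finset.mem_coe, Finset.mem_powerset] at hA hB
    have hBM : oddPairChoice k B ⊆ M A := hAB ▸ hsub B
    exact (subset_of_oddPairChoice_subset (hmax A).2.1 hA (hsub A) hBM).antisymm
      (subset_of_oddPairChoice_subset (hmax A).2.1 hB hBM (hsub A))
  have hcard := Set.ncard_le_ncard_of_injOn M (fun A _ => hmax A) hinj hfin
  rw [Set.ncard_coe_finset, Finset.card_powerset, Finset.card_range] at hcard
  rwa [Nat.mul_div_cancel_left k (by norm_num)]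
end

section
/- For every ε > 0 there exists N such that for all n ≥ N there is a family F of subsets of [n] with the following properties: (i) every member A of F contains at most εn² Schur triples; (ii) every sum-free set S ⊆ [n] is contained in some member of F; (iii) |F| ≤ 2^{εn}; (iv) every member A of F satisfies |A| ≤ (1/2 + ε)n. -/
/-- The number of Schur triples in `A`: pairs `(x, y) ∈ A × A` with `x + y ∈ A`. -/
def schurTriples (A : Finset ℕ) : ℕ :=
  ((A ×ˢ A).filter (fun p => p.1 + p.2 ∈ A)).card

open Finset in
/-- A set with `2|A| ≥ n + e` inside `[n]` has at least `e(e-1)/2` Schur triples. -/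
theorem mul_pred_le_two_mul_schurTriples (e : ℕ) : ∀ (n : ℕ) (A : Finset ℕ), A ⊆ Icc 1 n →
    n + e ≤ 2 * #A → e * (e - 1) ≤ 2 * schurTriples A := by
  induction e with
  | zero => intros; simp
  | succ e ih =>
    intro n A hA h
    have hne : A.Nonempty := by
      rw [← card_pos]
      omega
    set m := A.max' hne with hm
    have hmA : m ∈ A := A.max'_mem hne
    have hmn := mem_Icc.1 (hA hmA)
    set B := A.erase m with hB
    have hBcard : #B + 1 = #A := card_erase_add_one hmA
    have hBsub : B ⊆ Icc 1 (m - 1) := by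
      intro x hx
      have hx1 := mem_Icc.1 (hA (mem_of_mem_erase hx))
      have hx2 := A.lt_max'_of_mem_erase_max' hne hx
      rw [mem_Icc]
      omega
    have h1 := ih (m - 1) B hBsub (by omega)
    set R := B.image (fun x => m - x) with hR
    have hRcard : #R = #B := by
      apply card_image_of_injOn
      intro x hx y hy hxy
      have hx1 := mem_Icc.1 (hBsub hx)
      have hy1 := mem_Icc.1 (hBsub hy)
      simp only at hxy
      omega
    have hRsub : R ⊆ Icc 1 (m - 1) := by
      intro x hx
      obtain ⟨y, hy, rfl⟩ := mem_image.1 hx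
      have hy1 := mem_Icc.1 (hBsub hy)
      rw [mem_Icc]
      omega
    have hunion : #(B ∪ R) ≤ m - 1 := by
      simpa using card_le_card (union_subset hBsub hRsub)
    have hinter : e ≤ #(B ∩ R) := by
      have := card_union_add_card_inter B R
      omega
    have h2 : schurTriples B + #(B ∩ R) ≤ schurTriples A := by
      have hinj : #((B ∩ R).image (fun x => (x, m - x))) = #(B ∩ R) := by
        apply card_image_of_injective
        intro x y hxy
        exact (Prod.mk.inj hxy).1
      rw [← hinj]
      unfold schurTriples
      rw [← card_union_of_disjoint]
      · apply card_le_card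
        intro p hp
        rcases mem_union.1 hp with hp | hp
        · simp only [mem_filter, mem_product] at hp ⊢
          exact ⟨⟨mem_of_mem_erase hp.1.1, mem_of_mem_erase hp.1.2⟩, mem_of_mem_erase hp.2⟩
        · obtain ⟨x, hx, rfl⟩ := mem_image.1 hp
          obtain ⟨hxB, hxR⟩ := mem_inter.1 hx
          obtain ⟨y, hy, rfl⟩ := mem_image.1 hxR
          have hy1 := mem_Icc.1 (hBsub hy)
          have e1 : m - (m - y) = y := by omega
          have e2 : m - y + y = m := by omega
          simp only [mem_filter, mem_product, e1, e2]
          exact ⟨⟨mem_of_mem_erase hxB, mem_of_mem_erase hy⟩, hmA⟩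
      · rw [disjoint_left]
        intro p hp hp'
        obtain ⟨x, hx, rfl⟩ := mem_image.1 hp'
        have hx1 := mem_Icc.1 (hBsub (mem_inter.1 hx).1)
        have e2 : x + (m - x) = m := by omega
        simp only [mem_filter, e2] at hp
        exact notMem_erase m A hp.2
    have h3 : (e + 1) * (e + 1 - 1) = e * (e - 1) + 2 * e := by
      cases e with
      | zero => rfl
      | succ k => simp only [Nat.add_sub_cancel]; ring
    omega

open Finset in
theorem card_le_of_schurTriples_le {ε : ℝ} {n : ℕ} (hn : 2 ≤ ε * n) {A : Finset ℕ}
    (hA : A ⊆ Icc 1 n) (h : (schurTriples A : ℝ) ≤ ε ^ 2 / 2 * n ^ 2) :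
    (#A : ℝ) ≤ (1 / 2 + ε) * n := by
  by_contra! hlt
  set e := ⌊2 * (ε * n)⌋₊ with he
  have h1 : (e : ℝ) ≤ 2 * (ε * n) := Nat.floor_le (by linarith)
  have h2 : 2 * (ε * n) < e + 1 := Nat.lt_floor_add_one _
  have h3 : n + e ≤ 2 * #A := by
    have : (n + e : ℝ) ≤ 2 * #A := by linarith
    exact_mod_cast this
  have h4 := mul_pred_le_two_mul_schurTriples e n A hA h3
  have h5 : 1 ≤ e := by
    have : (0 : ℝ) < e := by linarith
    exact_mod_cast this
  have h6 : (e : ℝ) * (e - 1) ≤ 2 * schurTriples A := by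
    have : ((e * (e - 1) : ℕ) : ℝ) ≤ (2 * schurTriples A : ℕ) := by exact_mod_cast h4
    push_cast [h5] at this
    exact this
  nlinarith

open Finset in
open Classical in
/-- The vertices of `A` outside the neighbourhood of `T` having fewer than `b` neighbours in `A`
outside the neighbourhood of `T`. -/
noncomputable def graphContainer (r : ℕ → ℕ → Prop) (A : Finset ℕ) (b : ℝ) (T : Finset ℕ) :
    Finset ℕ :=
  {v ∈ A | (¬ ∃ t ∈ T, r t v) ∧ (#{w ∈ A | r v w ∧ ¬ ∃ t ∈ T, r t w} : ℝ) < b}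

open Finset in
open Classical in
/-- Every independent set has a small subset whose container contains it. -/
theorem exists_subset_graphContainer {r : ℕ → ℕ → Prop} {A S : Finset ℕ}
    {b : ℝ} (hb : 0 < b) (hSA : S ⊆ A) (hS : ∀ x ∈ S, ∀ y ∈ S, ¬ r x y) :
    ∃ T ⊆ S, b * #T ≤ #A ∧ S ⊆ graphContainer r A b T := by
  set Q := {T ∈ S.powerset | b * #T ≤ #{w ∈ A | ∃ t ∈ T, r t w}} with hQ
  obtain ⟨T, hTQ, hTmax⟩ := Q.exists_max_image card ⟨∅, by simp [hQ]⟩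
  simp only [hQ, mem_filter, mem_powerset] at hTQ
  obtain ⟨hTS, hT⟩ := hTQ
  refine ⟨T, hTS, hT.trans (by exact_mod_cast card_filter_le _ _), fun v hv => ?_⟩
  simp only [graphContainer, mem_filter]
  refine ⟨hSA hv, fun ⟨t, ht, htv⟩ => hS t (hTS ht) v hv htv, ?_⟩
  by_contra hge
  rw [not_lt] at hge
  have hvT : v ∉ T := by
    intro hvT
    have : #{w ∈ A | r v w ∧ ¬ ∃ t ∈ T, r t w} = 0 := by
      rw [card_eq_zero, filter_eq_empty_iff]
      rintro w - ⟨h1, h2⟩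
      exact h2 ⟨v, hvT, h1⟩
    rw [this] at hge
    push_cast at hge
    linarith
  have hins : insert v T ∈ Q := by
    simp only [hQ, mem_filter, mem_powerset]
    refine ⟨insert_subset hv hTS, ?_⟩
    have hdis : Disjoint {w ∈ A | ∃ t ∈ T, r t w} {w ∈ A | r v w ∧ ¬ ∃ t ∈ T, r t w} := by
      rw [disjoint_left]
      intro w hw hw'
      exact (mem_filter.1 hw').2.2 (mem_filter.1 hw).2
    have hcard : #{w ∈ A | ∃ t ∈ T, r t w} + #{w ∈ A | r v w ∧ ¬ ∃ t ∈ T, r t w} ≤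
        #{w ∈ A | ∃ t ∈ insert v T, r t w} := by
      rw [← card_union_of_disjoint hdis]
      apply card_le_card
      intro w hw
      simp only [mem_union, mem_filter, exists_mem_insert] at hw ⊢
      tauto
    have hcard' : (#{w ∈ A | ∃ t ∈ T, r t w} : ℝ) + #{w ∈ A | r v w ∧ ¬ ∃ t ∈ T, r t w} ≤
        #{w ∈ A | ∃ t ∈ insert v T, r t w} := by exact_mod_cast hcard
    rw [card_insert_of_notMem hvT]
    push_cast
    linarith
  have := hTmax _ hins
  rw [card_insert_of_notMem hvT] at this
  omega

open Finset in
open Classical in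
/-- A container in a graph with large degree sum misses many vertices. -/
theorem sum_degree_le_of_graphContainer {r : ℕ → ℕ → Prop} (hr : ∀ x y, r x y → r y x)
    {A : Finset ℕ} {b Δ : ℝ} (hb : 0 ≤ b) (hΔ : ∀ x, (#{w ∈ A | r x w} : ℝ) ≤ Δ)
    (T : Finset ℕ) :
    ∑ x ∈ A, (#{w ∈ A | r x w} : ℝ) ≤
      2 * Δ * (#A - #(graphContainer r A b T)) + b * #A := by
  set C := graphContainer r A b T with hC
  set M := {w ∈ A | ∃ t ∈ T, r t w} with hM
  have hCA : C ⊆ A := by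
    intro v hv
    simp only [hC, graphContainer, mem_filter] at hv
    exact hv.1
  have hΔ0 : 0 ≤ Δ := le_trans (by positivity) (hΔ 0)
  have hMC : M ⊆ A \ C := by
    intro v hv
    simp only [hM, mem_filter] at hv
    simp only [hC, graphContainer, mem_sdiff, mem_filter]
    exact ⟨hv.1, fun h => h.2.1 hv.2⟩
  have hAC : (#(A \ C) : ℝ) = #A - #C := by
    have := card_sdiff_add_card_eq_card hCA
    rw [← this]
    push_cast
    ring
  have hsplit : ∑ x ∈ A, (#{w ∈ A | r x w} : ℝ) =
      ∑ x ∈ A \ C, (#{w ∈ A | r x w} : ℝ) + ∑ x ∈ C, (#{w ∈ A | r x w} : ℝ) :=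
    (sum_sdiff hCA).symm
  have h1 : ∑ x ∈ A \ C, (#{w ∈ A | r x w} : ℝ) ≤ #(A \ C) * Δ := by
    rw [← nsmul_eq_mul]
    exact sum_le_card_nsmul _ _ _ fun x _ => hΔ x
  have h2 : ∑ x ∈ C, (#{w ∈ A | r x w} : ℝ) ≤ ∑ x ∈ C, ((#{w ∈ M | r x w} : ℝ) + b) := by
    apply sum_le_sum
    intro x hx
    simp only [hC, graphContainer, mem_filter] at hx
    have h3 : #{w ∈ A | r x w} ≤ #{w ∈ M | r x w} + #{w ∈ A | r x w ∧ ¬ ∃ t ∈ T, r t w} := by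
      refine le_trans (card_le_card ?_) (card_union_le _ _)
      intro w hw
      simp only [hM, mem_union, mem_filter] at hw ⊢
      by_cases h : ∃ t ∈ T, r t w
      · exact Or.inl ⟨⟨hw.1, h⟩, hw.2⟩
      · exact Or.inr ⟨hw.1, hw.2, h⟩
    have h4 : (#{w ∈ A | r x w} : ℝ) ≤
        #{w ∈ M | r x w} + #{w ∈ A | r x w ∧ ¬ ∃ t ∈ T, r t w} := by exact_mod_cast h3
    linarith [hx.2.2]
  have h3 : ∑ x ∈ C, (#{w ∈ M | r x w} : ℝ) ≤ #(A \ C) * Δ := by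
    have hcomm : ∑ x ∈ C, #{w ∈ M | r x w} = ∑ w ∈ M, #{x ∈ C | r x w} :=
      sum_card_bipartiteAbove_eq_sum_card_bipartiteBelow r
    have hcomm' : ∑ x ∈ C, (#{w ∈ M | r x w} : ℝ) = ∑ w ∈ M, (#{x ∈ C | r x w} : ℝ) := by
      exact_mod_cast hcomm
    rw [hcomm']
    calc ∑ w ∈ M, (#{x ∈ C | r x w} : ℝ) ≤ ∑ w ∈ M, Δ := by
          apply sum_le_sum
          intro w _
          refine le_trans ?_ (hΔ w)
          exact_mod_cast card_le_card fun x hx => by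
            simp only [mem_filter] at hx ⊢
            exact ⟨hCA hx.1, hr _ _ hx.2⟩
      _ = #M * Δ := by rw [sum_const, nsmul_eq_mul]
      _ ≤ #(A \ C) * Δ := by
          gcongr
  have h4 : ∑ x ∈ C, b ≤ b * #A := by
    rw [sum_const, nsmul_eq_mul, mul_comm]
    gcongr
  rw [sum_add_distrib] at h2
  rw [hAC] at h1 h3
  linarith

open Finset in
/-- There are few small subsets of `[n]`. -/
theorem exists_card_small_subsets_le {δ : ℝ} (hδ : 0 < δ) :
    ∃ η : ℝ, 0 < η ∧ ∀ n : ℕ,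
      (#{T ∈ (Icc 1 n).powerset | (#T : ℝ) ≤ η * n} : ℝ) ≤ (2 : ℝ) ^ (δ * n) := by
  set y : ℝ := (2 : ℝ) ^ (δ / 2) with hy
  have hy1 : 1 < y := Real.one_lt_rpow (by norm_num) (by linarith)
  set x : ℝ := min (y - 1) (1 / 2) with hx
  have hx0 : 0 < x := lt_min (by linarith) (by norm_num)
  have hx1 : x < 1 := lt_of_le_of_lt (min_le_right _ _) (by norm_num)
  have hxy : x + 1 ≤ y := by linarith [min_le_left (y - 1) (1 / 2 : ℝ)]
  have hlogx : Real.log x < 0 := Real.log_neg hx0 hx1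
  have hlogy : 0 < Real.log y := Real.log_pos hy1
  set η : ℝ := Real.log y / (-Real.log x) with hη
  have hxη : x ^ η = y⁻¹ := by
    rw [Real.rpow_def_of_pos hx0, ← Real.exp_log (inv_pos.2 (by linarith : 0 < y)), Real.log_inv]
    congr 1
    rw [hη, div_neg, mul_neg, mul_div_cancel₀ _ hlogx.ne]
  refine ⟨η, div_pos hlogy (by linarith), fun n => ?_⟩
  set P := {T ∈ (Icc 1 n).powerset | (#T : ℝ) ≤ η * n} with hP
  have h1 : ∑ T ∈ (Icc 1 n).powerset, x ^ #T = (x + 1) ^ n := by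
    simpa using sum_pow_mul_eq_add_pow x 1 (Icc 1 n)
  have h2 : (#P : ℝ) * (y⁻¹) ^ n ≤ ∑ T ∈ (Icc 1 n).powerset, x ^ #T := by
    calc (#P : ℝ) * (y⁻¹) ^ n = ∑ T ∈ P, (y⁻¹) ^ n := by rw [sum_const, nsmul_eq_mul]
      _ ≤ ∑ T ∈ P, x ^ #T := by
          apply sum_le_sum
          intro T hT
          rw [← hxη, ← Real.rpow_natCast, ← Real.rpow_natCast, ← Real.rpow_mul hx0.le]
          exact Real.rpow_le_rpow_of_exponent_ge hx0 hx1.le (mem_filter.1 hT).2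
      _ ≤ _ := sum_le_sum_of_subset_of_nonneg (filter_subset _ _) fun _ _ _ => by positivity
  have h3 : (x + 1) ^ n ≤ y ^ n := by gcongr
  have h4 : (2 : ℝ) ^ (δ * n) = y ^ n * y ^ n := by
    rw [hy, ← Real.rpow_mul_natCast (by norm_num), ← Real.rpow_add (by norm_num)]
    congr 1
    ring
  have hyn : 0 < y ^ n := by positivity
  rw [inv_pow, ← div_eq_mul_inv, div_le_iff₀ hyn, h1] at h2
  rw [h4]
  nlinarith

/-- The graph joining two naturals whose difference lies in `U`. -/
def DiffAdj (U : Finset ℕ) (x y : ℕ) : Prop := ∃ d ∈ U, x + d = y ∨ y + d = x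

theorem DiffAdj.symm {U : Finset ℕ} {x y : ℕ} (h : DiffAdj U x y) : DiffAdj U y x := by
  obtain ⟨d, hd, h⟩ := h
  exact ⟨d, hd, h.symm⟩

open Finset in
open Classical in
theorem card_diffAdj_le (U A : Finset ℕ) (x : ℕ) : #{w ∈ A | DiffAdj U x w} ≤ 2 * #U := by
  have hsub : {w ∈ A | DiffAdj U x w} ⊆ U.image (x + ·) ∪ U.image (x - ·) := by
    intro w hw
    obtain ⟨-, d, hd, h | h⟩ := mem_filter.1 hw
    · exact mem_union_left _ (mem_image.2 ⟨d, hd, h⟩)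
    · exact mem_union_right _ (mem_image.2 ⟨d, hd, by omega⟩)
  have h1 := card_le_card hsub
  have h2 := card_union_le (U.image (x + ·)) (U.image (x - ·))
  have h3 : #(U.image (x + ·)) ≤ #U := card_image_le
  have h4 : #(U.image (x - ·)) ≤ #U := card_image_le
  omega

open Finset in
open Classical in
theorem sum_card_le_sum_card_diffAdj (U A : Finset ℕ) :
    ∑ d ∈ U, #{x ∈ A | x + d ∈ A} ≤ ∑ x ∈ A, #{w ∈ A | DiffAdj U x w} := by
  have hcomm : ∑ d ∈ U, #{x ∈ A | x + d ∈ A} = ∑ x ∈ A, #{d ∈ U | x + d ∈ A} :=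
    sum_card_bipartiteAbove_eq_sum_card_bipartiteBelow fun d x => x + d ∈ A
  rw [hcomm]
  apply sum_le_sum
  intro x _
  rw [← card_image_of_injective _ (add_right_injective x)]
  apply card_le_card
  intro w hw
  obtain ⟨d, hd, rfl⟩ := mem_image.1 hw
  obtain ⟨hd, h⟩ := mem_filter.1 hd
  exact mem_filter.2 ⟨h, d, hd, Or.inl rfl⟩

open Finset in
theorem schurTriples_eq_sum (A : Finset ℕ) :
    schurTriples A = ∑ d ∈ A, #{x ∈ A | x + d ∈ A} := by
  unfold schurTriples
  rw [card_filter, sum_product_right]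
  simp_rw [card_filter]

open Finset in
/-- A subset of `[n]` with many Schur triples has many elements that occur in many of them. -/
theorem le_card_popular {ε : ℝ} {n : ℕ} (hε : 0 ≤ ε) (hn : 0 < n) {A : Finset ℕ}
    (hA : A ⊆ Icc 1 n) (h : ε * n ^ 2 < schurTriples A) :
    ε / 2 * n ≤ #{d ∈ A | ε / 2 * n ≤ (#{x ∈ A | x + d ∈ A} : ℝ)} := by
  have hAn : (#A : ℝ) ≤ n := by exact_mod_cast (by simpa using card_le_card hA)
  have hn' : (0 : ℝ) < n := by exact_mod_cast hn
  set D := {d ∈ A | ε / 2 * n ≤ (#{x ∈ A | x + d ∈ A} : ℝ)} with hD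
  have h1 : (schurTriples A : ℝ) = ∑ d ∈ D, (#{x ∈ A | x + d ∈ A} : ℝ) +
      ∑ d ∈ A with ¬ ε / 2 * n ≤ (#{x ∈ A | x + d ∈ A} : ℝ), (#{x ∈ A | x + d ∈ A} : ℝ) := by
    rw [schurTriples_eq_sum, hD, sum_filter_add_sum_filter_not]
    push_cast
    rfl
  have h2 : ∑ d ∈ D, (#{x ∈ A | x + d ∈ A} : ℝ) ≤ #D * (n : ℝ) := by
    rw [← nsmul_eq_mul]
    refine sum_le_card_nsmul _ _ _ fun d _ => hAn.trans' ?_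
    exact_mod_cast card_filter_le _ _
  have h3 : ∑ d ∈ A with ¬ ε / 2 * n ≤ (#{x ∈ A | x + d ∈ A} : ℝ), (#{x ∈ A | x + d ∈ A} : ℝ) ≤
      n * (ε / 2 * n) := by
    calc _ ≤ #{d ∈ A | ¬ ε / 2 * n ≤ (#{x ∈ A | x + d ∈ A} : ℝ)} • (ε / 2 * n) :=
          sum_le_card_nsmul _ _ _ fun d hd => (not_le.1 (mem_filter.1 hd).2).le
      _ ≤ n * (ε / 2 * n) := by
          rw [nsmul_eq_mul]
          gcongr
          exact (card_filter_le _ _).trans (by simpa using card_le_card hA)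
  have h4 : ε / 2 * n * n ≤ #D * (n : ℝ) := by nlinarith
  exact le_of_mul_le_mul_right h4 hn'

open Finset in
open Classical in
/-- A set with many Schur triples can be replaced by few smaller containers. -/
theorem exists_smaller_containers {ε δ : ℝ} (hε : 0 < ε) (hδ : 0 < δ) :
    ∃ N : ℕ, ∀ n : ℕ, N ≤ n → ∀ A ⊆ Icc 1 n, ε * n ^ 2 < schurTriples A →
      ∃ F : Finset (Finset ℕ), (∀ B ∈ F, B ⊆ Icc 1 n ∧ (#B : ℝ) ≤ #A - ε / 16 * n) ∧
        (∀ S ⊆ A, SumFree S → ∃ B ∈ F, S ⊆ B) ∧ (#F : ℝ) ≤ (2 : ℝ) ^ (δ * n) := by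
  obtain ⟨η, hη, hcount⟩ := exists_card_small_subsets_le (half_pos hδ)
  obtain ⟨K, hK⟩ := exists_nat_gt (4 / (ε * η))
  have hK0 : (0 : ℝ) < K := lt_trans (by positivity) hK
  have hK4 : 4 < K * (ε * η) := (div_lt_iff₀ (by positivity)).1 hK
  obtain ⟨N, hN⟩ := exists_nat_gt (max (K / η) (K / (7 / 16 * ε)))
  refine ⟨N, fun n hn A hA hschur => ?_⟩
  have hnN : (N : ℝ) ≤ n := by exact_mod_cast hn
  have hKη : K ≤ η * n := by
    have := (div_lt_iff₀ hη).1 (lt_of_le_of_lt (le_max_left _ _) (hN.trans_le hnN))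
    linarith
  have hKε : K ≤ 7 / 16 * ε * n := by
    have := (div_lt_iff₀ (by positivity)).1
      (lt_of_le_of_lt (le_max_right _ _) (hN.trans_le hnN))
    linarith
  have hn0 : (0 : ℝ) < n := by
    by_contra! h
    nlinarith
  have hAn : (#A : ℝ) ≤ n := by exact_mod_cast (by simpa using card_le_card hA)
  set D := {d ∈ A | ε / 2 * n ≤ (#{x ∈ A | x + d ∈ A} : ℝ)} with hD
  have hDcard : ε / 2 * n ≤ #D :=
    le_card_popular hε.le (by exact_mod_cast hn0) hA hschur
  have hDA : D ⊆ A := filter_subset _ _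
  set P := {T ∈ (Icc 1 n).powerset | (#T : ℝ) ≤ η * n} with hP
  set b : ℝ := ε / 4 * K with hb
  have hb0 : 0 < b := by positivity
  let f : Finset ℕ × Finset ℕ → Finset ℕ := fun p =>
    if #p.1 < K then A \ D ∪ p.1 else graphContainer (DiffAdj p.1) A b p.2
  refine ⟨{B ∈ (P ×ˢ P).image f | B ⊆ Icc 1 n ∧ (#B : ℝ) ≤ #A - ε / 16 * n},
    fun B hB => (mem_filter.1 hB).2, fun S hSA hS => ?_, ?_⟩
  · have memP : ∀ T ⊆ S, (#T : ℝ) ≤ η * n → T ∈ P := fun T hT h =>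
      mem_filter.2 ⟨mem_powerset.2 (hT.trans (hSA.trans hA)), h⟩
    by_cases hSD : #(S ∩ D) < K
    · have hlt : (#(S ∩ D) : ℝ) < K := by exact_mod_cast hSD
      have hf : f (S ∩ D, ∅) = A \ D ∪ (S ∩ D) := if_pos hSD
      refine ⟨f (S ∩ D, ∅), mem_filter.2 ⟨mem_image_of_mem f (mem_product.2
        ⟨memP _ inter_subset_left (by linarith), memP _ (empty_subset _) ?_⟩), ?_, ?_⟩, ?_⟩
      · simp only [card_empty, Nat.cast_zero]
        positivity
      · rw [hf]
        exact union_subset (sdiff_subset.trans hA) (inter_subset_right.trans (hDA.trans hA))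
      · rw [hf]
        have h1 : (#(A \ D ∪ (S ∩ D)) : ℝ) ≤ #(A \ D) + #(S ∩ D) := by
          exact_mod_cast card_union_le _ _
        have h2 : (#(A \ D) : ℝ) + #D = #A := by
          exact_mod_cast card_sdiff_add_card_eq_card hDA
        linarith
      · rw [hf]
        intro x hx
        simp only [mem_union, mem_sdiff, mem_inter]
        have := hSA hx
        tauto
    · obtain ⟨U, hU, hUK⟩ := exists_subset_card_eq (not_lt.1 hSD)
      have hUS : U ⊆ S := hU.trans inter_subset_left
      have hind : ∀ x ∈ S, ∀ y ∈ S, ¬ DiffAdj U x y := by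
        rintro x hx y hy ⟨d, hd, rfl | rfl⟩
        · exact hS x hx d (hUS hd) hy
        · exact hS y hy d (hUS hd) hx
      obtain ⟨T, hTS, hTcard, hST⟩ := exists_subset_graphContainer hb0 hSA hind
      have hf : f (U, T) = graphContainer (DiffAdj U) A b T := if_neg (by simp [hUK])
      refine ⟨f (U, T), mem_filter.2 ⟨mem_image_of_mem f (mem_product.2
        ⟨memP _ hUS (by rw [hUK]; exact hKη), memP _ hTS ?_⟩), ?_, ?_⟩, by rwa [hf]⟩
      · have h1 : b * #T ≤ b * (η * n) := by
          have : (n : ℝ) ≤ b * η * n := by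
            rw [hb]
            nlinarith
          linarith
        exact le_of_mul_le_mul_left h1 hb0
      · rw [hf]
        intro x hx
        simp only [graphContainer, mem_filter] at hx
        exact hA hx.1
      · rw [hf]
        have h1 := sum_degree_le_of_graphContainer (r := DiffAdj U) (fun _ _ => DiffAdj.symm)
          (A := A) hb0.le (Δ := 2 * K)
          (fun x => by rw [← hUK]; exact_mod_cast card_diffAdj_le U A x) T
        have h2 : (∑ d ∈ U, (#{x ∈ A | x + d ∈ A} : ℝ)) ≤
            ∑ x ∈ A, (#{w ∈ A | DiffAdj U x w} : ℝ) := by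
          exact_mod_cast sum_card_le_sum_card_diffAdj U A
        have h3 : K * (ε / 2 * n) ≤ ∑ d ∈ U, (#{x ∈ A | x + d ∈ A} : ℝ) := by
          rw [← hUK, ← nsmul_eq_mul]
          exact card_nsmul_le_sum _ _ _ fun d hd =>
            (mem_filter.1 (inter_subset_right (hU hd))).2
        have h4 : b * #A ≤ b * n := by gcongr
        set c : ℝ := (#(graphContainer (DiffAdj U) A b T) : ℝ)
        have h5 : (4 * K) * (ε / 16 * n) ≤ (4 * K) * (#A - c) := by
          rw [hb] at h1 h4
          linarith
        have := le_of_mul_le_mul_left h5 (by positivity)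
        linarith
  · have h1 : #{B ∈ (P ×ˢ P).image f | B ⊆ Icc 1 n ∧ (#B : ℝ) ≤ #A - ε / 16 * n} ≤ #P * #P :=
      (card_filter_le _ _).trans (card_image_le.trans (card_product _ _).le)
    have h2 : (#P : ℝ) ≤ (2 : ℝ) ^ (δ / 2 * n) := hcount n
    calc (#{B ∈ (P ×ˢ P).image f | B ⊆ Icc 1 n ∧ (#B : ℝ) ≤ #A - ε / 16 * n} : ℝ)
        ≤ #P * #P := by exact_mod_cast h1
      _ ≤ (2 : ℝ) ^ (δ / 2 * n) * (2 : ℝ) ^ (δ / 2 * n) := by gcongr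
      _ = (2 : ℝ) ^ (δ * n) := by
          rw [← Real.rpow_add (by norm_num)]
          congr 1
          ring

open Finset in
open Classical in
theorem exists_containers_or_card_le {ε : ℝ} (hε : 0 < ε) (k : ℕ) :
    ∀ δ : ℝ, 0 < δ → ∃ N : ℕ, ∀ n : ℕ, N ≤ n → ∃ F : Finset (Finset ℕ),
      (∀ A ∈ F, A ⊆ Icc 1 n) ∧
      (∀ A ∈ F, (schurTriples A : ℝ) ≤ ε * n ^ 2 ∨ (#A : ℝ) ≤ n - k * (ε / 16 * n)) ∧
      (∀ S ⊆ Icc 1 n, SumFree S → ∃ A ∈ F, S ⊆ A) ∧ (#F : ℝ) ≤ (2 : ℝ) ^ (δ * n) := by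
  induction k with
  | zero =>
    intro δ hδ
    refine ⟨0, fun n _ => ⟨{Icc 1 n}, by simp, by simp, fun S hS _ => ⟨_, mem_singleton_self _, hS⟩,
      ?_⟩⟩
    rw [card_singleton, Nat.cast_one]
    exact Real.one_le_rpow (by norm_num) (by positivity)
  | succ k ih =>
    intro δ hδ
    obtain ⟨N₁, h₁⟩ := ih (δ / 2) (half_pos hδ)
    obtain ⟨N₂, h₂⟩ := exists_smaller_containers hε (half_pos hδ)
    refine ⟨max N₁ N₂, fun n hn => ?_⟩
    obtain ⟨F, hFn, hFs, hFc, hFcard⟩ := h₁ n (le_of_max_le_left hn)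
    have h2 := h₂ n (le_of_max_le_right hn)
    have hex : ∀ A ∈ F, ∃ G : Finset (Finset ℕ), (∀ B ∈ G, B ⊆ Icc 1 n ∧
        ((schurTriples B : ℝ) ≤ ε * n ^ 2 ∨ (#B : ℝ) ≤ n - (k + 1 : ℕ) * (ε / 16 * n))) ∧
        (∀ S ⊆ A, SumFree S → ∃ B ∈ G, S ⊆ B) ∧ (#G : ℝ) ≤ (2 : ℝ) ^ (δ / 2 * n) := by
      intro A hA
      by_cases hs : (schurTriples A : ℝ) ≤ ε * n ^ 2
      · refine ⟨{A}, ?_, fun S hS _ => ⟨_, mem_singleton_self _, hS⟩, ?_⟩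
        · intro B hB
          rw [mem_singleton.1 hB]
          exact ⟨hFn A hA, Or.inl hs⟩
        · rw [card_singleton, Nat.cast_one]
          exact Real.one_le_rpow (by norm_num) (by positivity)
      · obtain ⟨G, hG, hGc, hGcard⟩ := h2 A (hFn A hA) (not_le.1 hs)
        refine ⟨G, fun B hB => ⟨(hG B hB).1, Or.inr ?_⟩, hGc, hGcard⟩
        have h3 := (hFs A hA).resolve_left hs
        have h4 := (hG B hB).2
        push_cast
        linarith
    choose! G hG hGc hGcard using hex
    refine ⟨F.biUnion G, fun B hB => ?_, fun B hB => ?_, fun S hS hSf => ?_, ?_⟩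
    · obtain ⟨A, hA, hB⟩ := mem_biUnion.1 hB
      exact (hG A hA B hB).1
    · obtain ⟨A, hA, hB⟩ := mem_biUnion.1 hB
      exact (hG A hA B hB).2
    · obtain ⟨A, hA, hSA⟩ := hFc S hS hSf
      obtain ⟨B, hB, hSB⟩ := hGc A hA S hSA hSf
      exact ⟨B, mem_biUnion.2 ⟨A, hA, hB⟩, hSB⟩
    · calc (#(F.biUnion G) : ℝ) ≤ ∑ A ∈ F, (#(G A) : ℝ) := by exact_mod_cast card_biUnion_le
        _ ≤ #F * (2 : ℝ) ^ (δ / 2 * n) := by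
            rw [← nsmul_eq_mul]
            exact sum_le_card_nsmul _ _ _ hGcard
        _ ≤ (2 : ℝ) ^ (δ / 2 * n) * (2 : ℝ) ^ (δ / 2 * n) := by gcongr
        _ = (2 : ℝ) ^ (δ * n) := by
            rw [← Real.rpow_add (by norm_num)]
            congr 1
            ring

theorem stmt3 :
    ∀ ε : ℝ, 0 < ε → ∃ N : ℕ, ∀ n : ℕ, N ≤ n →
      ∃ F : Finset (Finset ℕ),
        (∀ A ∈ F, A ⊆ Finset.Icc 1 n) ∧
        (∀ A ∈ F, (schurTriples A : ℝ) ≤ ε * n ^ 2) ∧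
        (∀ S : Finset ℕ, S ⊆ Finset.Icc 1 n → SumFree S → ∃ A ∈ F, S ⊆ A) ∧
        (F.card : ℝ) ≤ (2 : ℝ) ^ (ε * n) ∧
        (∀ A ∈ F, (A.card : ℝ) ≤ (1 / 2 + ε) * n) := by
  intro ε hε
  set ε' := min ε (ε ^ 2 / 2) with hε'
  have hε'0 : 0 < ε' := lt_min hε (by positivity)
  obtain ⟨k, hk⟩ := exists_nat_gt (1 / (ε' / 16))
  have hk1 : 1 < k * (ε' / 16) := (div_lt_iff₀ (by positivity)).1 hk
  obtain ⟨N₁, h₁⟩ := exists_containers_or_card_le hε'0 k ε hε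
  obtain ⟨N₂, h₂⟩ := exists_nat_gt (2 / ε)
  refine ⟨max N₁ N₂, fun n hn => ?_⟩
  obtain ⟨F, hFn, hFs, hFc, hFcard⟩ := h₁ n (le_of_max_le_left hn)
  have hn2 : (N₂ : ℝ) ≤ n := by exact_mod_cast le_of_max_le_right hn
  have hεn : 2 ≤ ε * n := by
    have := (div_lt_iff₀ hε).1 (h₂.trans_le hn2)
    linarith
  have hn0 : (0 : ℝ) < n := lt_of_lt_of_le (lt_trans (by positivity) h₂) hn2
  have hs : ∀ A ∈ F, (schurTriples A : ℝ) ≤ ε' * n ^ 2 := by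
    intro A hA
    refine (hFs A hA).resolve_right fun h => ?_
    have : (0 : ℝ) ≤ A.card := Nat.cast_nonneg _
    nlinarith
  refine ⟨F, hFn, fun A hA => (hs A hA).trans ?_, hFc, hFcard, fun A hA =>
    card_le_of_schurTriples_le hεn (hFn A hA) ((hs A hA).trans ?_)⟩
  · gcongr
    exact min_le_left _ _
  · gcongr
    exact min_le_right _ _
end
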